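/- arXiv:1512.07150 — 10 statements merged into one kernel-verified Lean document; each statement's English description precedes it below -/
import Mathlib

section
/- Suppose A : ℕ → Matrix (Fin n) (Fin n) ℝ (n > 1) satisfies Assumption 1 and the sequence of signed digraphs Γ(A(1)), Γ(A(2)), … is repeatedly jointly strongly connected. Then for every initial state x(1) ∈ ℝⁿ, the system x(t+1) = A(t)·x(t) asymptotically reaches a modulus consensus: there exists c ≥ 0 such that for every i ∈ Fin n, |xᵢ(t)| → c as t → ∞. -/
/-- Arc relation of the signed digraph `Γ(A)`: an arc from `i` to `j` whenever `A j i ≠ 0`. -/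
def arcOf {n : ℕ} (A : Matrix (Fin n) (Fin n) ℝ) (i j : Fin n) : Prop := A j i ≠ 0

/-- A step `w ↦ B *ᵥ w` with row-sum-one moduli pulls `|B *ᵥ w|` strictly below a bound `M` at
every out-neighbour of a vertex where `|w|` already lies below `M`. -/
theorem abs_mulVec_le_of_arcOf {n : ℕ} {B : Matrix (Fin n) (Fin n) ℝ} {w : Fin n → ℝ}
    {M β ε : ℝ} {u v : Fin n} (hrow : ∑ j, |B v j| = 1) (hM : ∀ j, |w j| ≤ M)
    (hβ : β ≤ |B v u|) (hε : 0 ≤ ε) (hu : |w u| ≤ M - ε) :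
    |B.mulVec w v| ≤ M - β * ε := by
  have h1 : |B.mulVec w v| ≤ ∑ j, |B v j| * |w j| := by
    simp only [Matrix.mulVec, dotProduct, ← abs_mul]
    exact Finset.abs_sum_le_sum_abs _ _
  have h2 : ∑ j, |B v j| * (M - |w j|) = M - ∑ j, |B v j| * |w j| := by
    simp only [mul_sub, Finset.sum_sub_distrib, ← Finset.sum_mul, hrow, one_mul]
  have h3 : |B v u| * (M - |w u|) ≤ ∑ j, |B v j| * (M - |w j|) :=
    Finset.single_le_sum (f := fun j => |B v j| * (M - |w j|))
      (fun j _ => mul_nonneg (abs_nonneg _) (sub_nonneg.2 (hM j))) (Finset.mem_univ u)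
  have h4 : β * ε ≤ |B v u| * (M - |w u|) :=
    mul_le_mul hβ (by linarith) hε (abs_nonneg _)
  linarith

theorem norm_mulVec_le {n : ℕ} {B : Matrix (Fin n) (Fin n) ℝ}
    (hrow : ∀ i, ∑ j, |B i j| = 1) (w : Fin n → ℝ) : ‖B.mulVec w‖ ≤ ‖w‖ := by
  refine (pi_norm_le_iff_of_nonneg (norm_nonneg w)).2 fun i => ?_
  have h := abs_mulVec_le_of_arcOf (u := i) (M := ‖w‖) (ε := 0) (hrow i)
    (fun j => norm_le_pi_norm w j) le_rfl le_rfl (by simpa using norm_le_pi_norm w i)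
  simpa using h

/-- A relation path leaving a set crosses its boundary. -/
theorem Relation.ReflTransGen.exists_crossing {V : Type*} {r : V → V → Prop} {S : Set V}
    {a b : V} (h : Relation.ReflTransGen r a b) (ha : a ∈ S) (hb : b ∉ S) :
    ∃ u v, r u v ∧ u ∈ S ∧ v ∉ S := by
  induction h with
  | refl => exact absurd ha hb
  | @tail c d _ hcd ih =>
    by_cases hc : c ∈ S
    · exact ⟨c, d, hcd, hc, hb⟩
    · exact ih hc

/-- A nonempty set growing along the arcs present at each time covers all vertices after
`card V + 1` windows if the arcs of every window form a strongly connected digraph. -/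
theorem spread_eq_univ {V : Type*} [Fintype V] {arc : ℕ → V → V → Prop} {S : ℕ → Finset V}
    {p q s : ℕ} (hp : 0 < p) (hs : q ≤ s)
    (hmono : ∀ t, s ≤ t → S t ⊆ S (t + 1))
    (harc : ∀ t, s ≤ t → ∀ u v, arc t u v → u ∈ S t → v ∈ S (t + 1))
    (hne : (S s).Nonempty)
    (hconn : ∀ k : ℕ, ∀ i j, Relation.ReflTransGen
      (fun u v => ∃ t : ℕ, q + k * p ≤ t ∧ t < q + (k + 1) * p ∧ arc t u v) i j) :
    S (s + (Fintype.card V + 1) * p) = Finset.univ := by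
  have hmono' : ∀ a b, s ≤ a → a ≤ b → S a ⊆ S b := by
    intro a b ha hab
    induction b, hab using Nat.le_induction with
    | base => exact subset_rfl
    | succ b hab ih => exact ih.trans (hmono b (ha.trans hab))
  obtain ⟨k₀, hk1, hk2⟩ : ∃ k, s ≤ q + k * p ∧ q + k * p ≤ s + p := by
    refine ⟨(s - q) / p + 1, ?_, ?_⟩
    · have := Nat.lt_div_mul_add (a := s - q) hp
      rw [add_mul]
      omega
    · have := Nat.div_mul_le_self (s - q) p
      rw [add_mul]
      omega
  have hgrow : ∀ r : ℕ, S (q + (k₀ + r) * p) = Finset.univ ∨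
      r + 1 ≤ (S (q + (k₀ + r) * p)).card := by
    intro r
    induction r with
    | zero => exact .inr (Finset.card_pos.2 (hne.mono (hmono' _ _ le_rfl hk1)))
    | succ r ih =>
      have hstart : s ≤ q + (k₀ + r) * p := hk1.trans (by gcongr; omega)
      have hstep : q + (k₀ + r) * p ≤ q + (k₀ + (r + 1)) * p := by gcongr; omega
      have hsub := hmono' _ _ hstart hstep
      by_cases huniv : S (q + (k₀ + r) * p) = Finset.univ
      · exact .inl (Finset.univ_subset_iff.1 (huniv ▸ hsub))
      right
      have hcard := ih.resolve_left huniv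
      obtain ⟨a, ha⟩ := Finset.card_pos.1 (by omega : 0 < (S (q + (k₀ + r) * p)).card)
      obtain ⟨b, hb⟩ : ∃ b, b ∉ S (q + (k₀ + r) * p) := by
        simpa [Finset.eq_univ_iff_forall] using huniv
      obtain ⟨u, v, ⟨t, ht1, ht2, huv⟩, hu, hv⟩ :=
        (hconn (k₀ + r) a b).exists_crossing (S := ↑(S (q + (k₀ + r) * p))) ha hb
      have hv' : v ∈ S (q + (k₀ + (r + 1)) * p) :=
        hmono' (t + 1) _ (by omega) ht2
          (harc t (by omega) u v huv (hmono' _ _ hstart ht1 hu))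
      have hlt := Finset.card_lt_card
        (Finset.ssubset_iff_subset_ne.2 ⟨hsub, fun h => hv (h ▸ hv')⟩)
      omega
  have hend : S (q + (k₀ + Fintype.card V) * p) = Finset.univ :=
    (hgrow _).resolve_right fun h => by
      have := (S (q + (k₀ + Fintype.card V) * p)).card_le_univ
      omega
  refine Finset.univ_subset_iff.1 (hend ▸ hmono' _ _ (hk1.trans (by gcongr; omega)) ?_)
  rw [add_mul, add_mul]
  omega

/-- Suppose `A` satisfies Assumption 1 and the sequence of signed digraphs
`Γ(A 1), Γ(A 2), …` is repeatedly jointly strongly connected. Then for every initial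
state, the system `x(t+1) = A(t) ⬝ x(t)` asymptotically reaches a modulus consensus:
there is `c ≥ 0` with `|xᵢ(t)| → c` for every `i`. -/
theorem modulus_consensus {n : ℕ} (hn : 1 < n) (A : ℕ → Matrix (Fin n) (Fin n) ℝ)
    (hdiag : ∀ t : ℕ, ∀ i : Fin n, 0 < A t i i)
    (hrow : ∀ t : ℕ, ∀ i : Fin n, ∑ j, |A t i j| = 1)
    (hbeta : ∃ β : ℝ, 0 < β ∧ ∀ t : ℕ, ∀ i j : Fin n, A t i j ≠ 0 → β ≤ |A t i j|)
    (hconn : ∃ p q : ℕ, 0 < p ∧ 0 < q ∧ ∀ k : ℕ, ∀ i j : Fin n,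
      Relation.ReflTransGen
        (fun u v : Fin n => ∃ t : ℕ, q + k * p ≤ t ∧ t < q + (k + 1) * p ∧ arcOf (A t) u v)
        i j)
    (x : ℕ → Fin n → ℝ)
    (hx : ∀ t : ℕ, 1 ≤ t → x (t + 1) = (A t).mulVec (x t)) :
    ∃ c : ℝ, 0 ≤ c ∧ ∀ i : Fin n,
      Filter.Tendsto (fun t : ℕ => |x t i|) Filter.atTop (nhds c) := by
  obtain ⟨β, hβ, hbeta⟩ := hbeta
  obtain ⟨p, q, hp, hq, hconn⟩ := hconn
  have hstep : ∀ t, 1 ≤ t → ‖x (t + 1)‖ ≤ ‖x t‖ := fun t ht =>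
    hx t ht ▸ norm_mulVec_le (hrow t) (x t)
  have hanti : Antitone fun t => ‖x (t + 1)‖ :=
    antitone_nat_of_succ_le fun t => hstep (t + 1) (by omega)
  obtain ⟨c, hc⟩ : ∃ c, Filter.Tendsto (fun t => ‖x t‖) Filter.atTop (nhds c) :=
    ⟨_, (Filter.tendsto_add_atTop_iff_nat 1).1 (tendsto_atTop_ciInf hanti
      ⟨0, by rintro _ ⟨t, rfl⟩; exact norm_nonneg _⟩)⟩
  set L := (Fintype.card (Fin n) + 1) * p with hL
  have hle : ∀ s t, 1 ≤ s → s ≤ t → ∀ j, |x t j| ≤ ‖x s‖ := by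
    intro s t hs hst j
    have h := hanti (show s - 1 ≤ t - 1 by omega)
    simp only [Nat.sub_add_cancel hs, Nat.sub_add_cancel (hs.trans hst)] at h
    exact (norm_le_pi_norm (x t) j).trans h
  have hcontract : ∀ s, q ≤ s → ∀ i,
      ‖x (s + L)‖ ≤ ‖x s‖ - β ^ L * (‖x s‖ - |x s i|) := by
    intro s hs i
    have hs1 : 1 ≤ s := by omega
    have hδ : 0 ≤ ‖x s‖ - |x s i| := sub_nonneg.2 (hle s s hs1 le_rfl i)
    let S : ℕ → Finset (Fin n) := fun t =>
      Finset.univ.filter fun j => |x t j| ≤ ‖x s‖ - β ^ (t - s) * (‖x s‖ - |x s i|)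
    have harc : ∀ t, s ≤ t → ∀ u v, arcOf (A t) u v → u ∈ S t → v ∈ S (t + 1) := by
      intro t ht u v huv hu
      simp only [S, Finset.mem_filter, Finset.mem_univ, true_and] at hu ⊢
      rw [hx t (hs1.trans ht), Nat.sub_add_comm ht, pow_succ', mul_assoc]
      exact abs_mulVec_le_of_arcOf (hrow t v) (hle s t hs1 ht) (hbeta t v u huv)
        (by positivity) hu
    have huniv : S (s + L) = Finset.univ :=
      spread_eq_univ (arc := fun t => arcOf (A t)) hp hs
        (fun t ht u => harc t ht u u (hdiag t u).ne') harc ⟨i, by simp [S]⟩ hconn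
    have hall : ∀ j, |x (s + L) j| ≤ ‖x s‖ - β ^ L * (‖x s‖ - |x s i|) := by
      intro j
      have hj : j ∈ S (s + L) := huniv ▸ Finset.mem_univ j
      simpa [S] using hj
    exact (pi_norm_le_iff_of_nonneg ((abs_nonneg _).trans (hall i))).2 hall
  refine ⟨c, ge_of_tendsto' hc fun t => norm_nonneg _, fun i => ?_⟩
  have hpow : 0 < β ^ L := pow_pos hβ L
  have hlower : Filter.Tendsto (fun t => ‖x t‖ - (‖x t‖ - ‖x (t + L)‖) / β ^ L)
      Filter.atTop (nhds c) := by
    simpa using hc.sub ((hc.sub (hc.comp (Filter.tendsto_add_atTop_nat L))).div_const (β ^ L))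
  refine tendsto_of_tendsto_of_tendsto_of_le_of_le' hlower hc ?_
    (Filter.Eventually.of_forall fun t => norm_le_pi_norm (x t) i)
  filter_upwards [Filter.eventually_ge_atTop q] with t ht
  have h := hcontract t ht i
  have h' : ‖x t‖ - |x t i| ≤ (‖x t‖ - ‖x (t + L)‖) / β ^ L := by
    rw [le_div_iff₀ hpow]
    linarith
  linarith
end

section
/- Suppose A : ℕ → Matrix (Fin n) (Fin n) ℝ (n > 1) satisfies Assumption 1, the sequence of signed digraphs Γ(A(1)), Γ(A(2)), … is repeatedly jointly strongly connected, and there is a vector b : Fin n → ℝ with b i ∈ {1, −1} for all i such that every Γ(A(t)) is structurally balanced with respect to the clustering b. Then the matrix product A(t)⋯A(2)A(1) converges exponentially fast to a rank-one matrix of the form b·cᵀ: there exist a nonzero vector c ∈ ℝⁿ, a constant C > 0, and λ ∈ [0,1) such that for all t ≥ 1, every entry of A(t)⋯A(2)A(1) − b·cᵀ has absolute value at most C·λᵗ. -/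
/-- The left product `A(t) ⋯ A(2) A(1)` of the matrices `A(1), …, A(t)`. -/
def leftProd {n : ℕ} (A : ℕ → Matrix (Fin n) (Fin n) ℝ) (t : ℕ) :
    Matrix (Fin n) (Fin n) ℝ :=
  (List.range t).foldl (fun M s => A (s + 1) * M) 1

open Filter Topology Matrix

/-- The left product `B (s + k - 1) ⋯ B (s + 1) B s` of `k` consecutive matrices. -/
def windowProd {ι : Type*} [Fintype ι] [DecidableEq ι] (B : ℕ → Matrix ι ι ℝ) (s : ℕ) :
    ℕ → Matrix ι ι ℝ
  | 0 => 1
  | k + 1 => B (s + k) * windowProd B s k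

section WindowProd

variable {ι : Type*} [Fintype ι] [DecidableEq ι]

lemma windowProd_add (B : ℕ → Matrix ι ι ℝ) (s k l : ℕ) :
    windowProd B s (k + l) = windowProd B (s + k) l * windowProd B s k := by
  induction l with
  | zero => simp [windowProd]
  | succ l ih => rw [← add_assoc, windowProd, ih, windowProd, Matrix.mul_assoc, add_assoc]

lemma windowProd_mem_rowStochastic {B : ℕ → Matrix ι ι ℝ} (hB : ∀ t, B t ∈ rowStochastic ℝ ι)
    (s k : ℕ) : windowProd B s k ∈ rowStochastic ℝ ι := by
  induction k with
  | zero => exact one_mem _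
  | succ k ih => exact mul_mem (hB _) ih

/-- Averaging with weights at least `δ` shrinks the spread of a vector by the factor `1 - δ`. -/
lemma mulVec_sub_mulVec_le {P : Matrix ι ι ℝ} (hP : P ∈ rowStochastic ℝ ι) {δ : ℝ}
    (hδ : ∀ i j, δ ≤ P i j) {x : ι → ℝ} {d : ℝ} (hx : ∀ i j, x i - x j ≤ d) (i j : ι) :
    (P *ᵥ x) i - (P *ᵥ x) j ≤ (1 - δ) * d := by
  have : Nonempty ι := ⟨i⟩
  obtain ⟨m, hm⟩ := Finite.exists_min x
  have hd : 0 ≤ d := by simpa using hx i i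
  have hlow : x m ≤ (P *ᵥ x) j := by
    calc x m = ∑ k, P j k * x m := by
          rw [← Finset.sum_mul, sum_row_of_mem_rowStochastic hP, one_mul]
      _ ≤ _ := Finset.sum_le_sum fun k _ =>
          mul_le_mul_of_nonneg_left (hm k) (nonneg_of_mem_rowStochastic hP)
  have hup : (P *ᵥ x) i ≤ x m + d - P i m * d := by
    have hterm : ∀ k, P i k * x k ≤ P i k * (x m + d) - if k = m then P i m * d else 0 := by
      intro k
      split_ifs with h
      · subst h; linarith
      · have := mul_le_mul_of_nonneg_left (show x k ≤ x m + d by linarith [hx k m])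
          (nonneg_of_mem_rowStochastic hP (i := i) (j := k))
        linarith
    calc (P *ᵥ x) i ≤ ∑ k, (P i k * (x m + d) - if k = m then P i m * d else 0) :=
          Finset.sum_le_sum fun k _ => hterm k
      _ = _ := by
          rw [Finset.sum_sub_distrib, ← Finset.sum_mul, sum_row_of_mem_rowStochastic hP]
          simp
  have := mul_le_mul_of_nonneg_right (hδ i m) hd
  linarith

lemma abs_mulVec_sub_le {P : Matrix ι ι ℝ} (hP : P ∈ rowStochastic ℝ ι) {x : ι → ℝ} {d : ℝ}
    (hx : ∀ i j, x i - x j ≤ d) (i j : ι) : |(P *ᵥ x) i - x j| ≤ d := by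
  have h : (P *ᵥ x) i - x j = ∑ k, P i k * (x k - x j) := by
    simp only [mul_sub, Finset.sum_sub_distrib]
    rw [← Finset.sum_mul, sum_row_of_mem_rowStochastic hP, one_mul]
    rfl
  rw [h]
  calc |∑ k, P i k * (x k - x j)| ≤ ∑ k, |P i k * (x k - x j)| :=
        Finset.abs_sum_le_sum_abs _ _
    _ ≤ ∑ k, P i k * d := by
        refine Finset.sum_le_sum fun k _ => ?_
        rw [abs_mul, abs_of_nonneg (nonneg_of_mem_rowStochastic hP)]
        refine mul_le_mul_of_nonneg_left (abs_le.2 ⟨?_, hx k j⟩) (nonneg_of_mem_rowStochastic hP)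
        linarith [hx j k]
    _ = d := by rw [← Finset.sum_mul, sum_row_of_mem_rowStochastic hP, one_mul]

/-- A walk from inside a set to outside of it uses a step leaving the set. -/
lemma exists_step_of_reflTransGen {α : Type*} {r : α → α → Prop} {S : α → Prop} {a c : α}
    (h : Relation.ReflTransGen r a c) (ha : S a) (hc : ¬ S c) : ∃ u v, r u v ∧ S u ∧ ¬ S v := by
  by_contra! hcl
  exact hc (h.rec ha fun _ huv ih => hcl _ _ huv ih)

/-- A growing sequence of finite sets that gains an element over each window of length `p` until
it is everything is everything after `card ι` windows. -/
lemma eq_univ_of_window_growth {F : ℕ → Finset ι} (hF : Monotone F) (h0 : (F 0).Nonempty) {p : ℕ}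
    (hgrow : ∀ k, F (k * p) ≠ Finset.univ → F (k * p) ≠ F ((k + 1) * p)) :
    F (Fintype.card ι * p) = Finset.univ := by
  have key : ∀ k, F (k * p) = Finset.univ ∨ k + 1 ≤ (F (k * p)).card := by
    intro k
    induction k with
    | zero => right; simpa [Nat.one_le_iff_ne_zero, Finset.card_eq_zero] using h0.ne_empty
    | succ k ih =>
      have hle : F (k * p) ≤ F ((k + 1) * p) := hF (Nat.mul_le_mul_right _ k.le_succ)
      by_cases hu : F (k * p) = Finset.univ
      · left; exact Finset.univ_subset_iff.1 (hu ▸ hle)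
      · right
        have := Finset.card_lt_card (lt_of_le_of_ne hle (hgrow k hu))
        have := ih.resolve_left hu
        omega
  refine (key _).resolve_right fun h => ?_
  have := Finset.card_le_univ (F (Fintype.card ι * p))
  omega

/-- Over `card ι` consecutive windows with strongly connected union, the product of the matrices
is entrywise bounded below. -/
lemma pow_le_windowProd {B : ℕ → Matrix ι ι ℝ} (hB : ∀ t i j, 0 ≤ B t i j) {β : ℝ} (hβ0 : 0 ≤ β)
    (hdiag : ∀ t i, β ≤ B t i i) (hβ : ∀ t i j, B t i j ≠ 0 → β ≤ B t i j) {s p : ℕ}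
    (hconn : ∀ k i j, Relation.ReflTransGen
      (fun u v => ∃ t, s + k * p ≤ t ∧ t < s + (k + 1) * p ∧ B t v u ≠ 0) i j) (i j : ι) :
    β ^ (Fintype.card ι * p) ≤ windowProd B s (Fintype.card ι * p) i j := by
  have hW : ∀ k u v, 0 ≤ windowProd B s k u v := by
    intro k
    induction k with
    | zero => intro u v; simp only [windowProd, Matrix.one_apply]; split_ifs <;> norm_num
    | succ k ih => exact fun u v => Finset.sum_nonneg fun w _ => mul_nonneg (hB _ _ _) (ih _ _)
  have hstep : ∀ k u v, β ≤ B (s + k) v u → β ^ k ≤ windowProd B s k u j →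
      β ^ (k + 1) ≤ windowProd B s (k + 1) v j := by
    intro k u v huv hu
    calc β ^ (k + 1) = β * β ^ k := pow_succ' _ _
      _ ≤ B (s + k) v u * windowProd B s k u j :=
          mul_le_mul huv hu (pow_nonneg hβ0 _) (hB _ _ _)
      _ ≤ _ := Finset.single_le_sum (f := fun w => B (s + k) v w * windowProd B s k w j)
          (fun w _ => mul_nonneg (hB _ _ _) (hW _ _ _)) (Finset.mem_univ u)
  classical
  let F : ℕ → Finset ι := fun k => {u | β ^ k ≤ windowProd B s k u j}
  have hmem : ∀ k u, u ∈ F k ↔ β ^ k ≤ windowProd B s k u j := by simp [F]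
  have hF : Monotone F := monotone_nat_of_le_succ fun k u hu =>
    (hmem _ _).2 (hstep k u u (hdiag _ _) ((hmem _ _).1 hu))
  have h0 : j ∈ F 0 := by simp [hmem, windowProd]
  have huniv := eq_univ_of_window_growth hF ⟨j, h0⟩ (p := p) fun k hne heq => by
    obtain ⟨v, hv⟩ : ∃ v, v ∉ F (k * p) := by
      by_contra! h
      exact hne (Finset.eq_univ_of_forall h)
    obtain ⟨u, w, ⟨t, ht1, ht2, ht⟩, hu, hw⟩ := exists_step_of_reflTransGen
      (S := (· ∈ F (k * p))) (hconn k j v) (hF (Nat.zero_le _) h0) hv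
    obtain ⟨l, rfl⟩ := Nat.exists_eq_add_of_le (show s ≤ t by omega)
    have hul : u ∈ F l := hF (by omega) hu
    have hwl : w ∈ F (l + 1) := (hmem _ _).2 (hstep l u w (hβ _ _ _ ht) ((hmem _ _).1 hul))
    exact hw (heq ▸ hF (by omega) hwl)
  exact (hmem _ _).1 (huniv ▸ Finset.mem_univ i)

/-- Geometric decay along blocks of length `N` is geometric decay. -/
lemma exists_geometric_bound {ρ : ℝ} (h0 : 0 < ρ) (h1 : ρ < 1) {q N : ℕ} (hN : 0 < N) :
    ∃ C lam : ℝ, 0 < C ∧ 0 ≤ lam ∧ lam < 1 ∧ ∀ t, ∃ k, (k = 0 ∨ q + k * N ≤ t) ∧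
      ρ ^ k ≤ C * lam ^ t := by
  set lam : ℝ := ρ ^ ((N : ℝ)⁻¹) with hlam
  have hpow : lam ^ N = ρ := Real.rpow_inv_natCast_pow h0.le hN.ne'
  have hl0 : 0 < lam := Real.rpow_pos_of_pos h0 _
  have hl1 : lam < 1 := Real.rpow_lt_one h0.le h1 (by positivity)
  refine ⟨(lam ^ (q + N))⁻¹, lam, by positivity, hl0.le, hl1, fun t => ⟨(t - q) / N, ?_, ?_⟩⟩
  · have := Nat.div_mul_le_self (t - q) N
    rcases le_or_gt q t with h | h
    · right; omega
    · left; simp [Nat.sub_eq_zero_of_le h.le]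
  · have hlt : t - q < ((t - q) / N) * N + N := Nat.lt_div_mul_add hN
    rw [inv_mul_eq_div, le_div_iff₀ (by positivity), ← hpow, ← pow_mul, ← pow_add]
    refine pow_le_pow_of_le_one hl0.le hl1.le ?_
    rw [Nat.mul_comm N]
    omega

/-- Products of stochastic matrices with positive diagonals, with nonzero entries bounded away
from zero and with repeatedly jointly strongly connected digraphs converge exponentially fast to
a matrix with equal rows. -/
theorem exists_windowProd_geometric_limit [Nonempty ι] {B : ℕ → Matrix ι ι ℝ}
    (hB : ∀ t, B t ∈ rowStochastic ℝ ι) (hdiag : ∀ t i, 0 < B t i i) {β : ℝ} (hβ0 : 0 < β)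
    (hβ : ∀ t i j, B t i j ≠ 0 → β ≤ B t i j) {a p q : ℕ} (hp : 0 < p) (haq : a ≤ q)
    (hconn : ∀ k i j, Relation.ReflTransGen
      (fun u v => ∃ t, q + k * p ≤ t ∧ t < q + (k + 1) * p ∧ B t v u ≠ 0) i j) :
    ∃ c : ι → ℝ, ∑ j, c j = 1 ∧ ∃ C lam : ℝ, 0 < C ∧ 0 ≤ lam ∧ lam < 1 ∧
      ∀ t i j, |windowProd B a t i j - c j| ≤ C * lam ^ t := by
  obtain ⟨i₀⟩ := ‹Nonempty ι›
  obtain ⟨r, rfl⟩ := Nat.exists_eq_add_of_le haq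
  set N := Fintype.card ι * p with hNdef
  have hN : 0 < N := Nat.mul_pos (Fintype.card_pos_iff.2 ⟨i₀⟩) hp
  have hβ1 : β ≤ 1 :=
    (hβ 0 i₀ i₀ (hdiag _ _).ne').trans (le_one_of_mem_rowStochastic (hB 0))
  have hδ0 : 0 < β ^ N := by positivity
  have hδ1 : β ^ N ≤ 1 := pow_le_one₀ hβ0.le hβ1
  set ρ := 1 - β ^ N / 2 with hρ
  have hW := windowProd_mem_rowStochastic hB
  have hpos : ∀ k i j, β ^ N / 2 ≤ windowProd B (a + (r + k * N)) N i j := by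
    intro k i j
    have h := pow_le_windowProd (B := B) (s := a + (r + k * N)) (p := p)
      (fun t i j => nonneg_of_mem_rowStochastic (hB t)) hβ0.le
      (fun t i => hβ _ _ _ (hdiag t i).ne') hβ (fun l u v => by
        have hl : ∀ m, a + (r + k * N) + m * p = a + r + (k * Fintype.card ι + m) * p := by
          intro m; rw [hNdef]; ring
        simpa only [hl, add_assoc] using hconn (k * Fintype.card ι + l) u v) i j
    linarith
  have hosc1 : ∀ t j i i', windowProd B a t i j - windowProd B a t i' j ≤ 1 := by
    intro t j i i'
    have h1 := le_one_of_mem_rowStochastic (hW a t) (i := i) (j := j)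
    have h2 := nonneg_of_mem_rowStochastic (hW a t) (i := i') (j := j)
    linarith
  have hblock : ∀ k j i i',
      windowProd B a (r + k * N) i j - windowProd B a (r + k * N) i' j ≤ ρ ^ k := by
    intro k
    induction k with
    | zero => intro j i i'; simpa using hosc1 r j i i'
    | succ k ih =>
      intro j i i'
      rw [show r + (k + 1) * N = (r + k * N) + N by ring, windowProd_add, pow_succ']
      exact mulVec_sub_mulVec_le (hW _ _) (hpos k) (ih j) i i'
  have hosc : ∀ k t, r + k * N ≤ t → ∀ j i i',
      windowProd B a t i j - windowProd B a t i' j ≤ ρ ^ k := by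
    intro k t ht j i i'
    obtain ⟨l, rfl⟩ := Nat.exists_eq_add_of_le ht
    rw [windowProd_add]
    have h := mulVec_sub_mulVec_le (hW (a + (r + k * N)) l) (δ := 0)
      (fun _ _ => nonneg_of_mem_rowStochastic (hW _ _)) (hblock k j) i i'
    rw [sub_zero, one_mul] at h
    exact h
  obtain ⟨C, lam, hC, hl0, hl1, hgeo⟩ :=
    exists_geometric_bound (ρ := ρ) (by linarith) (by linarith) (q := r) hN
  have hdecay : ∀ t j i i', windowProd B a t i j - windowProd B a t i' j ≤ C * lam ^ t := by
    intro t j i i'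
    obtain ⟨k, hk, hle⟩ := hgeo t
    refine le_trans ?_ hle
    rcases hk with rfl | hk
    · simpa using hosc1 t j i i'
    · exact hosc k t hk j i i'
  have hdist : ∀ t t', t ≤ t' → ∀ i i' j,
      |windowProd B a t' i' j - windowProd B a t i j| ≤ C * lam ^ t := by
    intro t t' ht i i' j
    obtain ⟨l, rfl⟩ := Nat.exists_eq_add_of_le ht
    rw [windowProd_add]
    exact abs_mulVec_sub_le (hW _ _) (hdecay t j) i' i
  have hlim0 : Tendsto (fun t => C * lam ^ t) atTop (𝓝 0) := by
    simpa using (tendsto_pow_atTop_nhds_zero_of_lt_one hl0 hl1).const_mul C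
  have hcauchy : ∀ j, ∃ c, Tendsto (fun t => windowProd B a t i₀ j) atTop (𝓝 c) := fun j =>
    cauchySeq_tendsto_of_complete <| cauchySeq_of_le_tendsto_0' _ (fun t t' ht => by
      rw [dist_comm, Real.dist_eq]; exact hdist t t' ht i₀ i₀ j) hlim0
  choose c hc using hcauchy
  refine ⟨c, ?_, C, lam, hC, hl0, hl1, fun t i j => ?_⟩
  · refine tendsto_nhds_unique (tendsto_finsetSum Finset.univ fun j _ => hc j) ?_
    simp [sum_row_of_mem_rowStochastic (hW a _)]
  · rw [abs_sub_comm]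
    refine le_of_tendsto ((hc j).sub_const _).abs ?_
    filter_upwards [eventually_ge_atTop t] with t' ht using hdist t t' ht i i₀ j

end WindowProd

/-- Conjugating by a `±1` diagonal turns `leftProd A` into the product of the absolute values. -/
lemma leftProd_eq_mul_windowProd_mul {n : ℕ} {A B : ℕ → Matrix (Fin n) (Fin n) ℝ}
    {b : Fin n → ℝ} (hb : ∀ i, b i * b i = 1) (hAB : ∀ t i j, A t i j = b i * B t i j * b j)
    (t : ℕ) (i j : Fin n) : leftProd A t i j = b i * windowProd B 1 t i j * b j := by
  induction t generalizing i with
  | zero =>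
    by_cases h : i = j
    · subst h; simp [leftProd, windowProd, hb]
    · simp [leftProd, windowProd, h]
  | succ t ih =>
    have h : leftProd A (t + 1) = A (t + 1) * leftProd A t := by
      simp [leftProd, List.range_succ]
    rw [h, windowProd, Matrix.mul_apply, Matrix.mul_apply, Finset.mul_sum, Finset.sum_mul]
    refine Finset.sum_congr rfl fun k _ => ?_
    rw [ih, hAB, Nat.add_comm 1 t]
    linear_combination b i * B (t + 1) i k * windowProd B 1 t k j * b j * hb k

/-- Suppose `A` satisfies Assumption 1, the sequence of signed digraphs
`Γ(A 1), Γ(A 2), …` is repeatedly jointly strongly connected, and every `Γ(A t)` is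
structurally balanced with respect to a clustering `b` (entries `±1`). Then the product
`A(t)⋯A(2)A(1)` converges exponentially fast to a rank-one matrix `b cᵀ` with `c ≠ 0`. -/
theorem product_converges_rank_one {n : ℕ} (hn : 1 < n)
    (A : ℕ → Matrix (Fin n) (Fin n) ℝ)
    (hdiag : ∀ t : ℕ, ∀ i : Fin n, 0 < A t i i)
    (hrow : ∀ t : ℕ, ∀ i : Fin n, ∑ j, |A t i j| = 1)
    (hbeta : ∃ β : ℝ, 0 < β ∧ ∀ t : ℕ, ∀ i j : Fin n, A t i j ≠ 0 → β ≤ |A t i j|)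
    (hconn : ∃ p q : ℕ, 0 < p ∧ 0 < q ∧ ∀ k : ℕ, ∀ i j : Fin n,
      Relation.ReflTransGen
        (fun u v : Fin n => ∃ t : ℕ, q + k * p ≤ t ∧ t < q + (k + 1) * p ∧ arcOf (A t) u v)
        i j)
    (b : Fin n → ℝ) (hb : ∀ i, b i = 1 ∨ b i = -1)
    (hbal : ∀ t : ℕ, ∀ i j : Fin n, A t j i ≠ 0 → Real.sign (A t j i) = b i * b j) :
    ∃ c : Fin n → ℝ, c ≠ 0 ∧ ∃ C : ℝ, 0 < C ∧ ∃ lam : ℝ, 0 ≤ lam ∧ lam < 1 ∧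
      ∀ t : ℕ, 1 ≤ t → ∀ i j : Fin n,
        |leftProd A t i j - b i * c j| ≤ C * lam ^ t := by
  obtain ⟨β, hβ0, hβ⟩ := hbeta
  obtain ⟨p, q, hp, hq, hconn⟩ := hconn
  have hbb : ∀ i, b i * b i = 1 := fun i => by rcases hb i with h | h <;> simp [h]
  have habs : ∀ i, |b i| = 1 := fun i => by rcases hb i with h | h <;> simp [h]
  set B : ℕ → Matrix (Fin n) (Fin n) ℝ := fun t i j => |A t i j| with hBdef
  have hAB : ∀ t i j, A t i j = b i * B t i j * b j := by
    intro t i j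
    rcases lt_trichotomy (A t i j) 0 with h | h | h
    · have hs := hbal t j i h.ne
      rw [Real.sign_of_neg h] at hs
      simp only [hBdef, abs_of_neg h]
      linear_combination -A t i j * hs
    · simp [hBdef, h]
    · have hs := hbal t j i h.ne'
      rw [Real.sign_of_pos h] at hs
      simp only [hBdef, abs_of_pos h]
      linear_combination A t i j * hs
  have : Nonempty (Fin n) := ⟨⟨0, by omega⟩⟩
  obtain ⟨c, hc, C, lam, hC, hl0, hl1, hle⟩ := exists_windowProd_geometric_limit (B := B) (a := 1)
    (fun t => mem_rowStochastic_iff_sum.2 ⟨fun i j => abs_nonneg _, hrow t⟩)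
    (fun t i => abs_pos.2 (hdiag t i).ne') hβ0 (fun t i j h => hβ t i j (abs_ne_zero.1 h))
    hp hq (by simpa only [hBdef, arcOf, ne_eq, abs_eq_zero] using hconn)
  refine ⟨fun j => c j * b j, fun h0 => ?_, C, hC, lam, hl0, hl1, fun t _ i j => ?_⟩
  · have hcj : ∀ j, c j = 0 := fun j => by
      have h := congrFun h0 j
      simp only [Pi.zero_apply] at h
      linear_combination b j * h - c j * hbb j
    simp [hcj] at hc
  · rw [leftProd_eq_mul_windowProd_mul hbb hAB,
      show b i * windowProd B 1 t i j * b j - b i * (c j * b j)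
        = b i * (windowProd B 1 t i j - c j) * b j by ring, abs_mul, abs_mul, habs, habs]
    simpa using hle t i j
end

section
/- (Theorem 2) Suppose A : ℕ → Matrix (Fin n) (Fin n) ℝ (n > 1) satisfies Assumption 1 and the sequence of signed digraphs Γ(A(1)), Γ(A(2)), … is repeatedly jointly strongly connected. Then the following are equivalent: (i) the system x(t+1) = A(t)·x(t) converges to zero exponentially fast for all initial conditions, i.e., there exist C > 0 and λ ∈ [0,1) such that for all 1 ≤ s ≤ t and all x ∈ ℝⁿ, ‖A(t−1)⋯A(s)·x‖ ≤ C·λ^{t−s}·‖x‖; (ii) the sequence Γ(A(1)), Γ(A(2)), … is repeatedly jointly structurally unbalanced. -/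
/-- The product `A(s+m-1) ⋯ A(s+1) A(s)` of the `m` matrices starting at time `s`
(the empty product for `m = 0` is the identity). -/
def prodFrom {n : ℕ} (A : ℕ → Matrix (Fin n) (Fin n) ℝ) (s m : ℕ) :
    Matrix (Fin n) (Fin n) ℝ :=
  (List.range m).foldl (fun M r => A (s + r) * M) 1

open Relation in
/-- If a set of vertices is closed under the arcs of time-varying digraphs (with self-loops) that
are jointly strongly connected over every window of length `P`, then it fills the vertex set after
`Fintype.card V` windows. -/
theorem eq_univ_of_jointly_connected {V : Type*} [Fintype V] (E : ℕ → V → V → Prop)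
    (P : ℕ) (hE : ∀ a u v, ReflTransGen (fun u v => ∃ t, a ≤ t ∧ t < a + P ∧ E t u v) u v)
    (S : ℕ → Set V) (hmono : Monotone S)
    (hstep : ∀ t u v, u ∈ S t → E t u v → v ∈ S (t + 1)) (a : ℕ) (hne : (S a).Nonempty) :
    S (a + Fintype.card V * P) = Set.univ := by
  have grow : ∀ c, (S c).Nonempty → S c ≠ Set.univ → (S c).ncard < (S (c + P)).ncard := by
    intro c ⟨u, hu⟩ hc
    refine Set.ncard_lt_ncard ((hmono (Nat.le_add_right c P)).ssubset_of_ne ?_) (Set.toFinite _)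
    intro heq
    refine hc (Set.eq_univ_of_forall fun v => ?_)
    induction hE c u v with
    | refl => exact hu
    | tail _ h ih =>
      obtain ⟨t, h1, h2, h3⟩ := h
      rw [heq]
      exact hmono (by lia) (hstep t _ _ (hmono h1 ih) h3)
  have key : ∀ k, k + 1 ≤ (S (a + k * P)).ncard ∨ S (a + k * P) = Set.univ := by
    intro k
    induction k with
    | zero => exact Or.inl (by simpa using Nat.succ_le_of_lt ((Set.ncard_pos (Set.toFinite _)).2 hne))
    | succ k ih =>
      have e : a + (k + 1) * P = a + k * P + P := by ring
      rw [e]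
      by_cases hu : S (a + k * P) = Set.univ
      · exact Or.inr (Set.univ_subset_iff.1 (hu ▸ hmono (Nat.le_add_right _ P)))
      · have := grow _ (hne.mono (hmono (Nat.le_add_right _ _))) hu
        have := ih.resolve_right hu
        exact Or.inl (by lia)
  refine (key (Fintype.card V)).resolve_left fun h => ?_
  have := Set.ncard_le_card (S (a + Fintype.card V * P))
  rw [Nat.card_eq_fintype_card] at this
  lia

/-- The arcs of the signed double cover of `Γ(A)`: the sign changes along negative arcs. -/
def coverArc {n : ℕ} (A : Matrix (Fin n) (Fin n) ℝ) (u v : Fin n × ℤˣ) : Prop :=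
  0 < ((u.2 : ℤ) : ℝ) * ((v.2 : ℤ) : ℝ) * A v.1 u.1

theorem exists_coverArc {n : ℕ} {A : Matrix (Fin n) (Fin n) ℝ} {i j : Fin n}
    (h : arcOf A i j) (σ : ℤˣ) : ∃ τ, coverArc A (i, σ) (j, τ) := by
  rcases lt_or_gt_of_ne h with h | h
  · refine ⟨-σ, ?_⟩
    rcases Int.units_eq_one_or σ with rfl | rfl <;> simpa [coverArc] using h
  · refine ⟨σ, ?_⟩
    rcases Int.units_eq_one_or σ with rfl | rfl <;> simpa [coverArc] using h

open Relation in
/-- The signed double cover of a strongly connected, structurally unbalanced family of signed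
digraphs is strongly connected. -/
theorem coverArc_connected {n : ℕ} (A : ℕ → Matrix (Fin n) (Fin n) ℝ) (T : ℕ → Prop)
    (hconn : ∀ i j, ReflTransGen (fun u v => ∃ t, T t ∧ arcOf (A t) u v) i j)
    (hunb : ¬ ∃ b : Fin n → ℝ, (∀ i, b i = 1 ∨ b i = -1) ∧ ∀ t, T t → ∀ i j : Fin n,
      (0 < A t j i → b i = b j) ∧ (A t j i < 0 → b i = -b j))
    (u v : Fin n × ℤˣ) :
    ReflTransGen (fun u v => ∃ t, T t ∧ coverArc (A t) u v) u v := by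
  set R := ReflTransGen (fun u v => ∃ t, T t ∧ coverArc (A t) u v)
  have lift : ∀ i j σ, ∃ τ, R (i, σ) (j, τ) := by
    intro i j σ
    induction hconn i j with
    | refl => exact ⟨σ, .refl⟩
    | tail _ h ih =>
      obtain ⟨τ, hτ⟩ := ih
      obtain ⟨t, ht, h⟩ := h
      obtain ⟨τ', h'⟩ := exists_coverArc h τ
      exact ⟨τ', hτ.tail ⟨t, ht, h'⟩⟩
  have neg : ∀ {i j σ τ}, R (i, σ) (j, τ) → R (i, -σ) (j, -τ) := by
    intro i j σ τ h
    refine ReflTransGen.lift (fun w : Fin n × ℤˣ => (w.1, -w.2)) ?_ _ _ h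
    rintro a b ⟨t, ht, h⟩
    exact ⟨t, ht, by simpa [coverArc] using h⟩
  have flip_of_flip : ∀ {i j σ τ}, R (i, σ) (j, τ) → R (i, σ) (j, -τ) → R (i, σ) (i, -σ) := by
    intro i j σ τ h1 h2
    obtain ⟨ρ, h⟩ := lift j i τ
    rcases eq_or_ne ρ σ with rfl | hρ
    · exact h2.trans (neg h)
    · rw [Int.units_ne_iff_eq_neg] at hρ
      exact h1.trans (hρ ▸ h)
  have flip : ∀ i σ, R (i, σ) (i, -σ) := by
    intro i σ
    by_contra hflip
    choose b hb using fun j => lift i j σ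
    have uniq : ∀ j τ, R (i, σ) (j, τ) → τ = b j := by
      intro j τ h
      by_contra hne
      rw [← ne_eq, Int.units_ne_iff_eq_neg] at hne
      exact hflip (flip_of_flip (hb j) (hne ▸ h))
    refine hunb ⟨fun j => ((b j : ℤ) : ℝ), fun j => ?_, fun t ht j k => ⟨fun h => ?_, fun h => ?_⟩⟩
    · rcases Int.units_eq_one_or (b j) with h | h <;> simp [h]
    · beta_reduce
      rw [← uniq k (b j) ((hb j).tail ⟨t, ht, ?_⟩)]
      rcases Int.units_eq_one_or (b j) with h' | h' <;> simpa [coverArc, h'] using h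
    · beta_reduce
      rw [← uniq k (-b j) ((hb j).tail ⟨t, ht, ?_⟩)]
      · simp
      · rcases Int.units_eq_one_or (b j) with h' | h' <;> simpa [coverArc, h'] using h
  obtain ⟨i, σ⟩ := u
  obtain ⟨j, τ⟩ := v
  obtain ⟨τ', h⟩ := lift i j σ
  rcases eq_or_ne τ τ' with rfl | hne
  · exact h
  · rw [Int.units_ne_iff_eq_neg] at hne
    exact hne ▸ h.trans (flip j τ')

theorem prodFrom_succ {n : ℕ} (A : ℕ → Matrix (Fin n) (Fin n) ℝ) (s m : ℕ) :
    prodFrom A s (m + 1) = A (s + m) * prodFrom A s m := by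
  simp [prodFrom, List.range_succ]

theorem prodFrom_add {n : ℕ} (A : ℕ → Matrix (Fin n) (Fin n) ℝ) (s m k : ℕ) :
    prodFrom A s (m + k) = prodFrom A (s + m) k * prodFrom A s m := by
  induction k with
  | zero => simp [prodFrom]
  | succ k ih => rw [← add_assoc, prodFrom_succ, ih, prodFrom_succ, add_assoc, mul_assoc]

theorem norm_mulVec_le_of_sum_abs {n : ℕ} {A : Matrix (Fin n) (Fin n) ℝ}
    (hrow : ∀ i, ∑ j, |A i j| = 1) (x : Fin n → ℝ) : ‖A.mulVec x‖ ≤ ‖x‖ := by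
  refine (pi_norm_le_iff_of_nonneg (norm_nonneg x)).2 fun i => ?_
  calc ‖∑ j, A i j * x j‖ ≤ ∑ j, ‖A i j * x j‖ := norm_sum_le _ _
    _ ≤ ∑ j, |A i j| * ‖x‖ := by
      gcongr with j
      rw [norm_mul, Real.norm_eq_abs]
      gcongr
      exact norm_le_pi_norm x j
    _ = ‖x‖ := by rw [← Finset.sum_mul, hrow, one_mul]

theorem norm_prodFrom_mulVec_le {n : ℕ} {A : ℕ → Matrix (Fin n) (Fin n) ℝ}
    (hrow : ∀ t i, ∑ j, |A t i j| = 1) (s m : ℕ) (x : Fin n → ℝ) :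
    ‖(prodFrom A s m).mulVec x‖ ≤ ‖x‖ := by
  induction m with
  | zero => simp [prodFrom]
  | succ m ih =>
    rw [prodFrom_succ, ← Matrix.mulVec_mulVec]
    exact (norm_mulVec_le_of_sum_abs (hrow _) _).trans ih

/-- The gap between a bound `M` and the lifted state propagates along the arcs of the cover. -/
theorem gap_propagates {n : ℕ} {A : Matrix (Fin n) (Fin n) ℝ} (hrow : ∀ i, ∑ j, |A i j| = 1)
    {β : ℝ} (hβ : ∀ i j, A i j ≠ 0 → β ≤ |A i j|) {M c : ℝ} (hc : 0 ≤ c)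
    {x : Fin n → ℝ} (hx : ‖x‖ ≤ M) {u v : Fin n × ℤˣ} (huv : coverArc A u v)
    (hu : c ≤ M - ((u.2 : ℤ) : ℝ) * x u.1) :
    β * c ≤ M - ((v.2 : ℤ) : ℝ) * A.mulVec x v.1 := by
  obtain ⟨j, τ⟩ := u
  obtain ⟨i, σ⟩ := v
  simp only [coverArc] at huv hu ⊢
  have habs : ∀ ρ : ℤˣ, |((ρ : ℤ) : ℝ)| = 1 := fun ρ => by
    rcases Int.units_eq_one_or ρ with rfl | rfl <;> simp
  have hA : |A i j| = ((τ : ℤ) : ℝ) * ((σ : ℤ) : ℝ) * A i j := by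
    rw [← abs_of_pos huv, abs_mul, abs_mul, habs, habs, one_mul, one_mul]
  have hτ : ((τ : ℤ) : ℝ) * ((τ : ℤ) : ℝ) = 1 := by
    rcases Int.units_eq_one_or τ with rfl | rfl <;> simp
  have hsum : M - ((σ : ℤ) : ℝ) * A.mulVec x i
      = ∑ k, (|A i k| * M - ((σ : ℤ) : ℝ) * (A i k * x k)) := by
    rw [Finset.sum_sub_distrib, ← Finset.sum_mul, hrow, one_mul, ← Finset.mul_sum]
    rfl
  have hnonneg : ∀ k, 0 ≤ |A i k| * M - ((σ : ℤ) : ℝ) * (A i k * x k) := by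
    intro k
    rw [sub_nonneg]
    refine (le_abs_self _).trans ?_
    rw [abs_mul, abs_mul, habs, one_mul]
    exact mul_le_mul_of_nonneg_left ((norm_le_pi_norm x k).trans hx) (abs_nonneg _)
  have hne : A i j ≠ 0 := fun h => by simp [h] at huv
  calc β * c ≤ |A i j| * (M - ((τ : ℤ) : ℝ) * x j) :=
        mul_le_mul (hβ i j hne) hu hc (abs_nonneg _)
    _ = |A i j| * M - ((σ : ℤ) : ℝ) * (A i j * x j) := by
        rw [mul_sub, hA]
        linear_combination (-((σ : ℤ) : ℝ) * A i j * x j) * hτ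
    _ ≤ _ := by
        rw [hsum]
        exact Finset.single_le_sum (f := fun k => |A i k| * M - ((σ : ℤ) : ℝ) * (A i k * x k))
          (fun k _ => hnonneg k) (Finset.mem_univ j)

open Relation in
/-- Uniform contraction over windows long enough for the signed double cover to be traversed. -/
theorem norm_prodFrom_mulVec_le_of_cover {n : ℕ} [NeZero n] {A : ℕ → Matrix (Fin n) (Fin n) ℝ}
    (hdiag : ∀ t i, 0 < A t i i) (hrow : ∀ t i, ∑ j, |A t i j| = 1) {β : ℝ} (hβ0 : 0 < β)
    (hβ : ∀ t i j, A t i j ≠ 0 → β ≤ |A t i j|) (P : ℕ)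
    (hcov : ∀ a u v, ReflTransGen (fun u v => ∃ t, a ≤ t ∧ t < a + P ∧ coverArc (A t) u v) u v)
    (s : ℕ) (x : Fin n → ℝ) :
    ‖(prodFrom A s (2 * n * P)).mulVec x‖ ≤ (1 - β ^ (2 * n * P)) * ‖x‖ := by
  let S : ℕ → Set (Fin n × ℤˣ) := fun m =>
    {u | β ^ m * ‖x‖ ≤ ‖x‖ - ((u.2 : ℤ) : ℝ) * (prodFrom A s m).mulVec x u.1}
  have hstep : ∀ m u v, u ∈ S m → coverArc (A (s + m)) u v → v ∈ S (m + 1) := by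
    intro m u v hu huv
    have := gap_propagates (hrow (s + m)) (hβ (s + m)) (by positivity)
      (norm_prodFrom_mulVec_le hrow s m x) huv hu
    rw [Matrix.mulVec_mulVec, ← prodFrom_succ, ← mul_assoc, ← pow_succ'] at this
    exact this
  have hmono : Monotone S := by
    refine monotone_nat_of_le_succ fun m u hu => hstep m u u hu ?_
    rcases Int.units_eq_one_or u.2 with h | h <;> simpa [coverArc, h] using hdiag _ _
  have hne : (S 0).Nonempty := by
    rcases le_total (x 0) 0 with h | h
    · exact ⟨(0, 1), by simpa [S, prodFrom] using h⟩
    · exact ⟨(0, -1), by simpa [S, prodFrom] using h⟩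
  have hfull := eq_univ_of_jointly_connected (fun m => coverArc (A (s + m))) P
    (fun a u v => ReflTransGen.mono (fun u v ⟨t, h1, h2, h⟩ =>
      ⟨t - s, by lia, by lia, by rwa [show s + (t - s) = t by lia]⟩) _ _ (hcov (s + a) u v)) S hmono hstep 0 hne
  have hcard : Fintype.card (Fin n × ℤˣ) = 2 * n := by
    rw [Fintype.card_prod, Fintype.card_fin, Fintype.card_units_int, mul_comm]
  rw [hcard, zero_add] at hfull
  have hmem : ∀ u, u ∈ S (2 * n * P) := fun u => hfull ▸ Set.mem_univ u
  have hbound : ∀ i, ‖(prodFrom A s (2 * n * P)).mulVec x i‖ ≤ (1 - β ^ (2 * n * P)) * ‖x‖ := by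
    intro i
    have h1 := hmem (i, 1)
    have h2 := hmem (i, -1)
    simp only [S, Set.mem_ofPred_eq, Units.val_one, Units.val_neg, Int.cast_one, Int.cast_neg]
      at h1 h2
    rw [Real.norm_eq_abs, abs_le]
    constructor <;> linarith
  exact (pi_norm_le_iff_of_nonneg ((norm_nonneg _).trans (hbound 0))).2 hbound

/-- Windows of the form `[q + k p, q + (k + 1) p)` occur in every interval of length
`q + 2 p`. -/
theorem exists_window_subset {p : ℕ} (hp : 0 < p) (q a : ℕ) :
    ∃ k, a ≤ q + k * p ∧ q + (k + 1) * p ≤ a + (q + 2 * p) := by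
  refine ⟨a / p + 1, ?_, ?_⟩
  · have := Nat.lt_div_mul_add (a := a) hp
    lia
  · have := Nat.div_mul_le_self a p
    lia

/-- Contraction over every window of a fixed length yields exponential decay. -/
theorem exp_decay_of_contraction {n : ℕ} {A : ℕ → Matrix (Fin n) (Fin n) ℝ}
    (hrow : ∀ t i, ∑ j, |A t i j| = 1) {L : ℕ} (hL : 1 < L) {δ : ℝ} (hδ0 : 0 < δ) (hδ1 : δ ≤ 1)
    (h : ∀ s x, ‖(prodFrom A s L).mulVec x‖ ≤ (1 - δ) * ‖x‖) :
    ∃ C : ℝ, 0 < C ∧ ∃ lam : ℝ, 0 ≤ lam ∧ lam < 1 ∧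
      ∀ s m x, ‖(prodFrom A s m).mulVec x‖ ≤ C * lam ^ m * ‖x‖ := by
  have hL' : (1 : ℝ) < L := by exact_mod_cast hL
  have hdiv : δ / L < 1 := (div_lt_one (by linarith)).2 (by linarith)
  have hdiv0 : 0 < δ / L := div_pos hδ0 (by linarith)
  obtain ⟨lam, hlam⟩ : ∃ lam, lam = 1 - δ / L := ⟨_, rfl⟩
  have hlam0 : 0 < lam := by linarith
  have hlam1 : lam < 1 := by linarith
  have hpow : 1 - δ ≤ lam ^ L := by
    have := one_add_mul_le_pow (a := -(δ / L)) (by linarith) L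
    rw [hlam, sub_eq_add_neg 1 (δ / L)]
    refine le_trans (le_of_eq ?_) this
    field_simp
    ring
  have hiter : ∀ k s x, ‖(prodFrom A s (k * L)).mulVec x‖ ≤ lam ^ (k * L) * ‖x‖ := by
    intro k s x
    induction k with
    | zero => simp [prodFrom]
    | succ k ih =>
      rw [add_mul, one_mul, prodFrom_add, ← Matrix.mulVec_mulVec]
      calc _ ≤ (1 - δ) * ‖(prodFrom A s (k * L)).mulVec x‖ := h _ _
        _ ≤ lam ^ L * (lam ^ (k * L) * ‖x‖) := by gcongr
        _ = _ := by ring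
  refine ⟨(lam ^ L)⁻¹, by positivity, lam, hlam0.le, hlam1, fun s m x => ?_⟩
  have hm : m / L * L + m % L = m := Nat.div_add_mod' m L
  calc ‖(prodFrom A s m).mulVec x‖
      = ‖(prodFrom A (s + m / L * L) (m % L)).mulVec ((prodFrom A s (m / L * L)).mulVec x)‖ := by
        rw [Matrix.mulVec_mulVec, ← prodFrom_add, hm]
    _ ≤ ‖(prodFrom A s (m / L * L)).mulVec x‖ := norm_prodFrom_mulVec_le hrow _ _ _
    _ ≤ lam ^ (m / L * L) * ‖x‖ := hiter _ _ _
    _ ≤ (lam ^ L)⁻¹ * lam ^ m * ‖x‖ := by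
        gcongr
        rw [inv_mul_eq_div, le_div_iff₀ (by positivity), ← pow_add]
        have := Nat.mod_lt m (show 0 < L by lia)
        exact pow_le_pow_of_le_one hlam0.le hlam1.le (by lia)

/-- A balancing sign vector is invariant under the dynamics. -/
theorem mulVec_eq_of_balanced {n : ℕ} {A : Matrix (Fin n) (Fin n) ℝ}
    (hrow : ∀ i, ∑ j, |A i j| = 1) {b : Fin n → ℝ}
    (hb : ∀ i j, (0 < A j i → b i = b j) ∧ (A j i < 0 → b i = -b j)) : A.mulVec b = b := by
  ext j
  calc ∑ i, A j i * b i = ∑ i, |A j i| * b j := by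
        refine Finset.sum_congr rfl fun i _ => ?_
        rcases lt_trichotomy (A j i) 0 with h | h | h
        · rw [(hb i j).2 h, abs_of_neg h]
          ring
        · simp [h]
        · rw [(hb i j).1 h, abs_of_pos h]
    _ = b j := by rw [← Finset.sum_mul, hrow, one_mul]

/-- Theorem 2: under Assumption 1 and repeated joint strong connectivity, the system
`x(t+1) = A(t) ⬝ x(t)` converges to zero exponentially fast for all initial conditions
if and only if the sequence of signed digraphs `Γ(A 1), Γ(A 2), …` is repeatedly jointly
structurally unbalanced. -/
theorem exp_zero_iff_repeatedly_jointly_structurally_unbalanced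
    {n : ℕ} (hn : 1 < n) (A : ℕ → Matrix (Fin n) (Fin n) ℝ)
    (hdiag : ∀ t : ℕ, ∀ i : Fin n, 0 < A t i i)
    (hrow : ∀ t : ℕ, ∀ i : Fin n, ∑ j, |A t i j| = 1)
    (hbeta : ∃ β : ℝ, 0 < β ∧ ∀ t : ℕ, ∀ i j : Fin n, A t i j ≠ 0 → β ≤ |A t i j|)
    (hconn : ∃ p q : ℕ, 0 < p ∧ 0 < q ∧ ∀ k : ℕ, ∀ i j : Fin n,
      Relation.ReflTransGen
        (fun u v : Fin n => ∃ t : ℕ, q + k * p ≤ t ∧ t < q + (k + 1) * p ∧ arcOf (A t) u v)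
        i j) :
    (∃ C : ℝ, 0 < C ∧ ∃ lam : ℝ, 0 ≤ lam ∧ lam < 1 ∧
        ∀ s t : ℕ, 1 ≤ s → s ≤ t → ∀ x : Fin n → ℝ,
          ‖(prodFrom A s (t - s)).mulVec x‖ ≤ C * lam ^ (t - s) * ‖x‖)
    ↔
    (∃ p q : ℕ, 0 < p ∧ 0 < q ∧ ∀ k : ℕ,
        ¬ ∃ b : Fin n → ℝ, (∀ i, b i = 1 ∨ b i = -1) ∧
          ∀ t : ℕ, q + k * p ≤ t → t < q + (k + 1) * p → ∀ i j : Fin n,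
            (0 < A t j i → b i = b j) ∧ (A t j i < 0 → b i = -b j)) := by
  constructor
  · rintro ⟨C, hC, lam, hlam0, hlam1, h⟩
    obtain ⟨p, hp⟩ := exists_pow_lt_of_lt_one (inv_pos.2 hC) hlam1
    have hpC : C * lam ^ (p + 1) < 1 := by
      have : lam ^ (p + 1) ≤ lam ^ p := pow_le_pow_of_le_one hlam0 hlam1.le (Nat.le_succ p)
      calc C * lam ^ (p + 1) < C * C⁻¹ := by gcongr; linarith
        _ = 1 := mul_inv_cancel₀ hC.ne'
    refine ⟨p + 1, 1, by lia, one_pos, ?_⟩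
    rintro k ⟨b, hb1, hb⟩
    have hinv : ∀ m ≤ p + 1, (prodFrom A (1 + k * (p + 1)) m).mulVec b = b := by
      intro m
      induction m with
      | zero => simp [prodFrom]
      | succ m ih =>
        intro hm
        rw [prodFrom_succ, ← Matrix.mulVec_mulVec, ih (by lia)]
        exact mulVec_eq_of_balanced (hrow _)
          (hb _ (by lia) (by rw [add_mul, one_mul]; lia))
    have hbpos : 0 < ‖b‖ := by
      refine norm_pos_iff.2 fun h0 => ?_
      have := hb1 ⟨0, by lia⟩
      simp [h0] at this
    have := h (1 + k * (p + 1)) (1 + k * (p + 1) + (p + 1)) (by lia) (by lia) b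
    rw [Nat.add_sub_cancel_left, hinv _ le_rfl] at this
    nlinarith
  · rintro ⟨p', q', hp', -, hunb⟩
    obtain ⟨p, q, hp, -, hconn⟩ := hconn
    obtain ⟨β, hβ0, hβ⟩ := hbeta
    have : NeZero n := ⟨by lia⟩
    have hβ1 : β ≤ 1 := by
      refine (hβ 0 0 0 (hdiag 0 0).ne').trans ?_
      rw [← hrow 0 0]
      exact Finset.single_le_sum (f := fun j => |A 0 0 j|) (fun j _ => abs_nonneg _)
        (Finset.mem_univ 0)
    obtain ⟨P, hP⟩ : ∃ P, P = (q + 2 * p) + (q' + 2 * p') := ⟨_, rfl⟩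
    have hcov : ∀ a u v, Relation.ReflTransGen
        (fun u v => ∃ t, a ≤ t ∧ t < a + P ∧ coverArc (A t) u v) u v := by
      intro a u v
      obtain ⟨k, hk1, hk2⟩ := exists_window_subset hp q a
      obtain ⟨k', hk1', hk2'⟩ := exists_window_subset hp' q' a
      have := coverArc_connected A (fun t => a ≤ t ∧ t < a + P)
        (fun i j => Relation.ReflTransGen.mono (fun u v ⟨t, h1, h2, h⟩ =>
          ⟨t, ⟨by lia, by lia⟩, h⟩) _ _ (hconn k i j))
        (fun ⟨b, hb1, hb⟩ => hunb k' ⟨b, hb1, fun t h1 h2 => hb t ⟨by lia, by lia⟩⟩) u v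
      simpa only [and_assoc] using this
    have hL : 1 < 2 * n * P := by
      have : 0 < P := by lia
      nlinarith
    obtain ⟨C, hC, lam, h0, h1, h⟩ := exp_decay_of_contraction hrow hL (pow_pos hβ0 _)
      (pow_le_one₀ hβ0.le hβ1) (norm_prodFrom_mulVec_le_of_cover hdiag hrow hβ0 hβ P hcov)
    exact ⟨C, hC, lam, h0, h1, fun s t _ _ x => h s (t - s) x⟩
end

section
/- (Proposition 3) Let A : Matrix (Fin n) (Fin n) ℝ. Suppose the signed digraph Γ(A) is strongly connected and structurally balanced with respect to a clustering b : Fin n → ℝ (b i ∈ {1, −1} for all i). Then the digraph Γ(Ā) of the expanded matrix Ā consists of two disjoint strongly connected components of the same size n: letting V₁ = {inl i : b i = 1} ∪ {inr j : b j = −1} and V₂ = {inl i : b i = −1} ∪ {inr j : b j = 1}, there is no arc of Γ(Ā) between V₁ and V₂ in either direction, and the subgraphs of Γ(Ā) induced on V₁ and on V₂ are each strongly connected. -/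
/-- The expanded (lifted) nonnegative matrix `Ā` of `A`, indexed by `Fin n ⊕ Fin n`. -/
def expand {n : ℕ} (A : Matrix (Fin n) (Fin n) ℝ) :
    Matrix (Fin n ⊕ Fin n) (Fin n ⊕ Fin n) ℝ :=
  Matrix.of fun u v =>
    match u, v with
    | Sum.inl i, Sum.inl j => max (A i j) 0
    | Sum.inl i, Sum.inr j => max (-(A i j)) 0
    | Sum.inr i, Sum.inl j => max (-(A i j)) 0
    | Sum.inr i, Sum.inr j => max (A i j) 0

/-- Arc relation of the digraph `Γ(Ā)`: an arc from `u` to `v` whenever `Ā v u ≠ 0`. -/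
def barArc {n : ℕ} (A : Matrix (Fin n) (Fin n) ℝ) (u v : Fin n ⊕ Fin n) : Prop :=
  expand A v u ≠ 0

/-- The vertices of `Γ(Ā)` whose signed clustering value (`b i` at `inl i`, `-b i` at `inr i`)
is `1`. -/
def positivePart {n : ℕ} (b : Fin n → ℝ) : Set (Fin n ⊕ Fin n) :=
  {u | Sum.elim (fun i => b i = 1) (fun j => b j = -1) u}

open Classical in
/-- The copy of the vertex `i` of `Γ(A)` that lies in `positivePart b`. -/
noncomputable def positiveLift {n : ℕ} (b : Fin n → ℝ) (i : Fin n) : Fin n ⊕ Fin n :=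
  if b i = 1 then Sum.inl i else Sum.inr i

theorem positiveLift_injective {n : ℕ} (b : Fin n → ℝ) :
    Function.Injective (positiveLift b) := by
  intro i j h
  unfold positiveLift at h
  split_ifs at h <;> simpa using h

theorem range_positiveLift {n : ℕ} {b : Fin n → ℝ} (hb : ∀ i, b i = 1 ∨ b i = -1) :
    Set.range (positiveLift b) = positivePart b := by
  ext u
  constructor
  · rintro ⟨i, rfl⟩
    rcases hb i with h | h <;> norm_num [positiveLift, positivePart, h]
  · rcases u with i | i <;> intro h <;> refine ⟨i, ?_⟩ <;>
      norm_num [positiveLift, show b i = _ from h]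

theorem ncard_positivePart {n : ℕ} {b : Fin n → ℝ} (hb : ∀ i, b i = 1 ∨ b i = -1) :
    (positivePart b).ncard = n := by
  rw [← range_positiveLift hb, Set.ncard_range_of_injective (positiveLift_injective b),
    Nat.card_fin]

theorem pos_or_neg_of_sign_eq {x y z : ℝ} (hx : x ≠ 0) (h : Real.sign x = y * z) :
    0 < x ∧ y * z = 1 ∨ x < 0 ∧ y * z = -1 := by
  rcases hx.lt_or_gt with hx | hx
  · exact .inr ⟨hx, h ▸ Real.sign_of_neg hx⟩
  · exact .inl ⟨hx, h ▸ Real.sign_of_pos hx⟩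

theorem barArc_positiveLift {n : ℕ} {A : Matrix (Fin n) (Fin n) ℝ} {b : Fin n → ℝ}
    (hb : ∀ i, b i = 1 ∨ b i = -1)
    (hbal : ∀ i j : Fin n, A j i ≠ 0 → Real.sign (A j i) = b i * b j)
    {i j : Fin n} (hij : arcOf A i j) :
    barArc A (positiveLift b i) (positiveLift b j) := by
  have h := pos_or_neg_of_sign_eq hij (hbal i j hij)
  rcases hb i with hi | hi <;> rcases hb j with hj | hj <;>
    norm_num [hi, hj] at h <;>
    norm_num [positiveLift, barArc, expand, hi, hj, h]

theorem reflTransGen_barArc_positivePart {n : ℕ} {A : Matrix (Fin n) (Fin n) ℝ}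
    {b : Fin n → ℝ} (hsc : ∀ i j : Fin n, Relation.ReflTransGen (arcOf A) i j)
    (hb : ∀ i, b i = 1 ∨ b i = -1)
    (hbal : ∀ i j : Fin n, A j i ≠ 0 → Real.sign (A j i) = b i * b j) :
    ∀ u ∈ positivePart b, ∀ v ∈ positivePart b, Relation.ReflTransGen
      (fun a c => a ∈ positivePart b ∧ c ∈ positivePart b ∧ barArc A a c) u v := by
  rw [← range_positiveLift hb]
  rintro _ ⟨i, rfl⟩ _ ⟨j, rfl⟩
  exact (hsc i j).lift (positiveLift b) fun k l hkl =>
    ⟨⟨k, rfl⟩, ⟨l, rfl⟩, barArc_positiveLift hb hbal hkl⟩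

theorem not_barArc_of_mem_positivePart {n : ℕ} {A : Matrix (Fin n) (Fin n) ℝ}
    {b : Fin n → ℝ} (hbal : ∀ i j : Fin n, A j i ≠ 0 → Real.sign (A j i) = b i * b j)
    {u v : Fin n ⊕ Fin n} (hu : u ∈ positivePart b) (hv : v ∈ positivePart (-b)) :
    ¬ barArc A u v := by
  rcases u with i | i <;> rcases v with j | j <;>
    simp only [positivePart, Set.mem_ofPred_eq, Sum.elim_inl, Sum.elim_inr, Pi.neg_apply,
      neg_eq_iff_eq_neg, neg_neg] at hu hv <;>
    by_cases hA : A j i = 0 <;>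
    first
    | simp [barArc, expand, hA]; done
    | have h := pos_or_neg_of_sign_eq hA (hbal i j hA)
      norm_num [hu, hv] at h
      simp [barArc, expand, h.le]

/-- Proposition 3: if `Γ(A)` is strongly connected and structurally balanced with respect
to the clustering `b`, then `Γ(Ā)` consists of two disjoint strongly connected components
of the same size `n`: `V₁ = {inl i : b i = 1} ∪ {inr j : b j = -1}` and
`V₂ = {inl i : b i = -1} ∪ {inr j : b j = 1}`, with no arc between them in either
direction and the induced subgraph on each of them strongly connected. -/
theorem expanded_graph_of_balanced_two_components {n : ℕ}
    (A : Matrix (Fin n) (Fin n) ℝ)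
    (hsc : ∀ i j : Fin n, Relation.ReflTransGen (arcOf A) i j)
    (b : Fin n → ℝ) (hb : ∀ i, b i = 1 ∨ b i = -1)
    (hbal : ∀ i j : Fin n, A j i ≠ 0 → Real.sign (A j i) = b i * b j) :
    ∀ V₁ V₂ : Set (Fin n ⊕ Fin n),
      V₁ = {u | Sum.elim (fun i => b i = 1) (fun j => b j = -1) u} →
      V₂ = {u | Sum.elim (fun i => b i = -1) (fun j => b j = 1) u} →
      Disjoint V₁ V₂ ∧ V₁.ncard = n ∧ V₂.ncard = n ∧
      (∀ u ∈ V₁, ∀ v ∈ V₂, ¬ barArc A u v ∧ ¬ barArc A v u) ∧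
      (∀ u ∈ V₁, ∀ v ∈ V₁,
        Relation.ReflTransGen (fun a c => a ∈ V₁ ∧ c ∈ V₁ ∧ barArc A a c) u v) ∧
      (∀ u ∈ V₂, ∀ v ∈ V₂,
        Relation.ReflTransGen (fun a c => a ∈ V₂ ∧ c ∈ V₂ ∧ barArc A a c) u v) := by
  have hneg : ∀ i, (-b) i = 1 ∨ (-b) i = -1 := fun i => by
    rcases hb i with h | h <;> simp [h]
  have hbal_neg : ∀ i j : Fin n, A j i ≠ 0 → Real.sign (A j i) = (-b) i * (-b) j :=
    fun i j h => by simpa using hbal i j h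
  have hV₂ : {u | Sum.elim (fun i => b i = -1) (fun j => b j = 1) u} = positivePart (-b) := by
    ext (i | i) <;> simp [positivePart, neg_eq_iff_eq_neg]
  rintro _ _ rfl rfl
  rw [hV₂, ← positivePart]
  refine ⟨?_, ncard_positivePart hb, ncard_positivePart hneg, fun u hu v hv =>
    ⟨not_barArc_of_mem_positivePart hbal hu hv,
      not_barArc_of_mem_positivePart hbal_neg hv ((neg_neg b).symm ▸ hu)⟩,
    reflTransGen_barArc_positivePart hsc hb hbal,
    reflTransGen_barArc_positivePart hsc hneg hbal_neg⟩
  rw [Set.disjoint_left]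
  rintro (i | i) h h' <;>
    norm_num [positivePart, show b i = _ from h] at h'
end

section
/- (Proposition 4) Let A : Matrix (Fin n) (Fin n) ℝ. Suppose the signed digraph Γ(A) is strongly connected and structurally unbalanced. Then the digraph Γ(Ā) of the expanded matrix Ā (on the 2n vertices Fin n ⊕ Fin n) is strongly connected. -/
theorem barArc_inl_inl {n : ℕ} {A : Matrix (Fin n) (Fin n) ℝ} {i j : Fin n} :
    barArc A (.inl i) (.inl j) ↔ 0 < A j i := by
  simp [barArc, expand]

theorem barArc_inl_inr {n : ℕ} {A : Matrix (Fin n) (Fin n) ℝ} {i j : Fin n} :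
    barArc A (.inl i) (.inr j) ↔ A j i < 0 := by
  simp [barArc, expand]

theorem barArc_inr_inl {n : ℕ} {A : Matrix (Fin n) (Fin n) ℝ} {i j : Fin n} :
    barArc A (.inr i) (.inl j) ↔ A j i < 0 := by
  simp [barArc, expand]

theorem barArc_inr_inr {n : ℕ} {A : Matrix (Fin n) (Fin n) ℝ} {i j : Fin n} :
    barArc A (.inr i) (.inr j) ↔ 0 < A j i := by
  simp [barArc, expand]

theorem barArc.swap {n : ℕ} {A : Matrix (Fin n) (Fin n) ℝ} {u v : Fin n ⊕ Fin n}
    (h : barArc A u v) : barArc A u.swap v.swap := by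
  cases u <;> cases v <;> exact h

theorem barArc_reachable_swap {n : ℕ} {A : Matrix (Fin n) (Fin n) ℝ} {u v : Fin n ⊕ Fin n}
    (h : Relation.ReflTransGen (barArc A) u v) :
    Relation.ReflTransGen (barArc A) u.swap v.swap :=
  h.lift Sum.swap fun _ _ => barArc.swap

/-- A walk in `Γ(A)` lifts to a walk in `Γ(Ā)` from either lift of its starting vertex. -/
theorem barArc_reachable_lift {n : ℕ} {A : Matrix (Fin n) (Fin n) ℝ} {i j : Fin n}
    (h : Relation.ReflTransGen (arcOf A) i j) :
    Relation.ReflTransGen (barArc A) (.inl i) (.inl j) ∨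
      Relation.ReflTransGen (barArc A) (.inl i) (.inr j) := by
  induction h with
  | refl => exact .inl .refl
  | tail _ hjk ih =>
    rcases lt_or_gt_of_ne hjk with hneg | hpos
    · exact ih.elim (fun h => .inr (h.tail (barArc_inl_inr.2 hneg)))
        fun h => .inl (h.tail (barArc_inr_inl.2 hneg))
    · exact ih.elim (fun h => .inl (h.tail (barArc_inl_inl.2 hpos)))
        fun h => .inr (h.tail (barArc_inr_inr.2 hpos))

/-- If no walk in `Γ(Ā)` joins the two lifts of the vertex `r`, then `Γ(A)` is structurally
balanced. -/
theorem balanced_of_not_reachable_inr {n : ℕ} {A : Matrix (Fin n) (Fin n) ℝ}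
    (hsc : ∀ i j : Fin n, Relation.ReflTransGen (arcOf A) i j) (r : Fin n)
    (hr : ¬ Relation.ReflTransGen (barArc A) (.inl r) (.inr r)) :
    ∃ b : Fin n → ℝ, (∀ i, b i = 1 ∨ b i = -1) ∧
      ∀ i j : Fin n, A j i ≠ 0 → Real.sign (A j i) = b i * b j := by
  classical
  have hexcl (j : Fin n) (hr' : Relation.ReflTransGen (barArc A) (.inl r) (.inr j)) :
      ¬ Relation.ReflTransGen (barArc A) (.inl r) (.inl j) := by
    intro hl
    rcases barArc_reachable_lift (hsc j r) with h | h
    · exact hr (hr'.trans (barArc_reachable_swap h))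
    · exact hr (hl.trans h)
  refine ⟨fun j => if Relation.ReflTransGen (barArc A) (.inl r) (.inl j) then 1 else -1,
    fun i => ite_eq_or_eq _ _ _, fun i j hij => ?_⟩
  rcases lt_or_gt_of_ne hij with hneg | hpos
  · rw [Real.sign_of_neg hneg]
    rcases barArc_reachable_lift (hsc r i) with hi | hi
    · have hj := hi.tail (barArc_inl_inr.2 hneg)
      simp [hi, hexcl j hj]
    · have hj := hi.tail (barArc_inr_inl.2 hneg)
      simp [hj, hexcl i hi]
  · rw [Real.sign_of_pos hpos]
    rcases barArc_reachable_lift (hsc r i) with hi | hi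
    · have hj := hi.tail (barArc_inl_inl.2 hpos)
      simp [hi, hj]
    · have hj := hi.tail (barArc_inr_inr.2 hpos)
      simp [hexcl i hi, hexcl j hj]

/-- Proposition 4: if the signed digraph `Γ(A)` is strongly connected and structurally
unbalanced, then the digraph `Γ(Ā)` of the expanded matrix is strongly connected. -/
theorem expanded_graph_of_unbalanced_strongly_connected {n : ℕ}
    (A : Matrix (Fin n) (Fin n) ℝ)
    (hsc : ∀ i j : Fin n, Relation.ReflTransGen (arcOf A) i j)
    (hunbal : ¬ ∃ b : Fin n → ℝ, (∀ i, b i = 1 ∨ b i = -1) ∧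
      ∀ i j : Fin n, A j i ≠ 0 → Real.sign (A j i) = b i * b j) :
    ∀ u v : Fin n ⊕ Fin n, Relation.ReflTransGen (barArc A) u v := by
  have hflip (i : Fin n) : Relation.ReflTransGen (barArc A) (.inl i) (.inr i) := by
    by_contra hi
    exact hunbal (balanced_of_not_reachable_inr hsc i hi)
  have hflip' (i : Fin n) : Relation.ReflTransGen (barArc A) (.inr i) (.inl i) :=
    barArc_reachable_swap (hflip i)
  have hinl (i j : Fin n) : Relation.ReflTransGen (barArc A) (.inl i) (.inl j) :=
    (barArc_reachable_lift (hsc i j)).elim id fun h => h.trans (hflip' j)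
  rintro (i | i) (j | j)
  · exact hinl i j
  · exact (hinl i j).trans (hflip j)
  · exact (hflip' i).trans (hinl i j)
  · exact barArc_reachable_swap (hinl i j)
end

section
/- (Lemma 4) Let A : Matrix (Fin n) (Fin n) ℝ and suppose the signed digraph Γ(A) is strongly connected and structurally unbalanced. Then there exists a negative directed closed walk in Γ(A): a finite sequence of vertices v₀, v₁, …, v_m with v₀ = v_m, each (v_{k−1}, v_k) an arc of Γ(A) (i.e., A v_k v_{k−1} ≠ 0), and the product of the signs of the traversed arcs equal to −1 (equivalently, an odd number of negative arcs counted with multiplicity). -/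
/-- `SignedWalk A i j s`: there is a directed walk from `i` to `j` in `Γ(A)` whose arc signs
multiply to `s`. -/
inductive SignedWalk {n : ℕ} (A : Matrix (Fin n) (Fin n) ℝ) (i : Fin n) : Fin n → ℝ → Prop
  | nil : SignedWalk A i i 1
  | snoc {j k : Fin n} {s : ℝ} : SignedWalk A i j s → A k j ≠ 0 →
      SignedWalk A i k (s * Real.sign (A k j))

namespace SignedWalk

variable {n : ℕ} {A : Matrix (Fin n) (Fin n) ℝ} {i j k : Fin n} {s t : ℝ}

theorem trans (h₁ : SignedWalk A i j s) (h₂ : SignedWalk A j k t) :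
    SignedWalk A i k (s * t) := by
  induction h₂ with
  | nil => simpa using h₁
  | snoc _ hA ih => simpa only [mul_assoc] using ih.snoc hA

theorem eq_one_or_neg_one (h : SignedWalk A i j s) : s = 1 ∨ s = -1 := by
  induction h with
  | nil => exact Or.inl rfl
  | snoc _ hA ih =>
    rcases ih with rfl | rfl <;>
      rcases Real.sign_apply_eq_of_ne_zero _ hA with h | h <;> simp [h]

theorem exists_of_reflTransGen (h : Relation.ReflTransGen (arcOf A) i j) :
    ∃ s, SignedWalk A i j s := by
  induction h with
  | refl => exact ⟨1, nil⟩
  | tail _ hA ih =>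
    obtain ⟨s, hs⟩ := ih
    exact ⟨_, hs.snoc hA⟩

theorem exists_sequence (h : SignedWalk A i j s) :
    ∃ m : ℕ, ∃ v : ℕ → Fin n, v 0 = i ∧ v m = j ∧
      (∀ k, k < m → A (v (k + 1)) (v k) ≠ 0) ∧
      (∏ k ∈ Finset.range m, Real.sign (A (v (k + 1)) (v k))) = s := by
  induction h with
  | nil => exact ⟨0, fun _ => i, by simp⟩
  | @snoc j l s _ hA ih =>
    obtain ⟨m, v, h0, hm, harc, hprod⟩ := ih
    have hv : ∀ k ≤ m, Function.update v (m + 1) l k = v k := fun k hk =>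
      Function.update_of_ne (by omega) _ _
    refine ⟨m + 1, Function.update v (m + 1) l, by rw [hv 0 (by omega), h0], by simp, ?_, ?_⟩
    · intro k hk
      rcases Nat.lt_succ_iff_lt_or_eq.mp hk with hk | rfl
      · rw [hv k hk.le, hv (k + 1) hk]
        exact harc k hk
      · rw [hv k le_rfl, Function.update_self, hm]
        exact hA
    · rw [Finset.prod_range_succ, Function.update_self, hv m le_rfl, hm, ← hprod]
      congr 1
      refine Finset.prod_congr rfl fun k hk => ?_
      have hk := Finset.mem_range.mp hk
      rw [hv k hk.le, hv (k + 1) hk]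

end SignedWalk

/-- If every closed walk of a strongly connected signed digraph is positive, then the digraph is
structurally balanced. -/
theorem exists_balancing_of_no_negative_closed_walk {n : ℕ} {A : Matrix (Fin n) (Fin n) ℝ}
    (hsc : ∀ i j : Fin n, Relation.ReflTransGen (arcOf A) i j)
    (hpos : ∀ i, ¬ SignedWalk A i i (-1)) :
    ∃ b : Fin n → ℝ, (∀ i, b i = 1 ∨ b i = -1) ∧
      ∀ i j : Fin n, A j i ≠ 0 → Real.sign (A j i) = b i * b j := by
  rcases isEmpty_or_nonempty (Fin n) with _ | ⟨⟨r⟩⟩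
  · exact ⟨fun _ => 1, isEmptyElim, isEmptyElim⟩
  choose b hb using fun i => SignedWalk.exists_of_reflTransGen (hsc r i)
  have hclosed : ∀ {s}, SignedWalk A r r s → s = 1 := fun {s} h =>
    h.eq_one_or_neg_one.resolve_right fun hs => hpos r (hs ▸ h)
  refine ⟨b, fun i => (hb i).eq_one_or_neg_one, fun i j hA => ?_⟩
  obtain ⟨c, hc⟩ := SignedWalk.exists_of_reflTransGen (hsc j r)
  have h₁ := hclosed ((hb j).trans hc)
  have h₂ := hclosed (((hb i).snoc hA).trans hc)
  rcases (hb i).eq_one_or_neg_one with hi | hi <;>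
    rcases (hb j).eq_one_or_neg_one with hj | hj <;>
    rw [hi] at h₂ ⊢ <;> rw [hj] at h₁ ⊢ <;>
    obtain rfl | rfl := hc.eq_one_or_neg_one <;> linarith

/-- Lemma 4: if the signed digraph `Γ(A)` is strongly connected and structurally
unbalanced, then there exists a negative directed closed walk in `Γ(A)`: a sequence of
vertices `v 0, v 1, …, v m` with `v 0 = v m`, each consecutive pair an arc, and the
product of the signs of the traversed arcs equal to `-1`. -/
theorem exists_negative_closed_walk {n : ℕ}
    (A : Matrix (Fin n) (Fin n) ℝ)
    (hsc : ∀ i j : Fin n, Relation.ReflTransGen (arcOf A) i j)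
    (hunbal : ¬ ∃ b : Fin n → ℝ, (∀ i, b i = 1 ∨ b i = -1) ∧
      ∀ i j : Fin n, A j i ≠ 0 → Real.sign (A j i) = b i * b j) :
    ∃ m : ℕ, 0 < m ∧ ∃ v : ℕ → Fin n, v 0 = v m ∧
      (∀ k, k < m → A (v (k + 1)) (v k) ≠ 0) ∧
      (∏ k ∈ Finset.range m, Real.sign (A (v (k + 1)) (v k))) = -1 := by
  by_contra hneg
  refine hunbal (exists_balancing_of_no_negative_closed_walk hsc fun i hi => hneg ?_)
  obtain ⟨m, v, h0, hm, harc, hprod⟩ := hi.exists_sequence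
  refine ⟨m, Nat.pos_of_ne_zero ?_, v, h0.trans hm.symm, harc, hprod⟩
  rintro rfl
  norm_num at hprod
end

section
/- (Corollary 1) Let A : Matrix (Fin n) (Fin n) ℝ and suppose the signed digraph Γ(A) is strongly connected and structurally unbalanced. Then there exists a negative directed cycle in Γ(A): a finite sequence of vertices v₀, v₁, …, v_m with v₀ = v_m, all of v₀, …, v_{m−1} pairwise distinct, each (v_{k−1}, v_k) an arc of Γ(A) (i.e., A v_k v_{k−1} ≠ 0), and the product of the signs of the traversed arcs equal to −1 (an odd number of negative arcs). -/
/-- There is a directed walk in `Γ(A)` from `i` to `j` with `m` arcs, the product of whose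
signs is `s`. -/
def HasSignedWalk {n : ℕ} (A : Matrix (Fin n) (Fin n) ℝ) (m : ℕ) (i j : Fin n) (s : ℝ) : Prop :=
  ∃ v : ℕ → Fin n, v 0 = i ∧ v m = j ∧ (∀ k < m, A (v (k + 1)) (v k) ≠ 0) ∧
    ∏ k ∈ Finset.range m, Real.sign (A (v (k + 1)) (v k)) = s

namespace HasSignedWalk

variable {n : ℕ} {A : Matrix (Fin n) (Fin n) ℝ} {i j l : Fin n} {m p : ℕ} {s t : ℝ}

theorem refl (i : Fin n) : HasSignedWalk A 0 i i 1 :=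
  ⟨fun _ => i, rfl, rfl, by simp, by simp⟩

theorem of_arc (h : A j i ≠ 0) : HasSignedWalk A 1 i j (Real.sign (A j i)) :=
  ⟨fun k => if k = 0 then i else j, by simp, by simp, by simpa using h, by simp⟩

theorem trans (h₁ : HasSignedWalk A m i j s) (h₂ : HasSignedWalk A p j l t) :
    HasSignedWalk A (m + p) i l (s * t) := by
  obtain ⟨u, hu0, hum, hu, rfl⟩ := h₁
  obtain ⟨w, hw0, hwp, hw, rfl⟩ := h₂
  set v : ℕ → Fin n := fun k => if k ≤ m then u k else w (k - m) with hv
  have hleft : ∀ k ≤ m, v k = u k := fun k hk => by simp [hv, hk]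
  have hright : ∀ k, v (m + k) = w k := fun k => by
    rcases Nat.eq_zero_or_pos k with rfl | hk
    · simp [hv, hum, hw0]
    · simp [hv, hk.ne']
  refine ⟨v, by rw [hleft 0 m.zero_le, hu0], by rw [hright, hwp], fun k hk => ?_, ?_⟩
  · rcases lt_or_ge k m with hkm | hkm
    · rw [hleft k hkm.le, hleft (k + 1) hkm]
      exact hu k hkm
    · obtain ⟨q, rfl⟩ := Nat.exists_eq_add_of_le hkm
      rw [add_assoc, hright, hright]
      exact hw q (by omega)
  · rw [Finset.prod_range_add]
    congr 1
    · refine Finset.prod_congr rfl fun k hk => ?_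
      have hk := Finset.mem_range.1 hk
      rw [hleft k hk.le, hleft (k + 1) hk]
    · refine Finset.prod_congr rfl fun k _ => ?_
      rw [add_assoc, hright, hright]

theorem segment {v : ℕ → Fin n} (hv : ∀ k < m, A (v (k + 1)) (v k) ≠ 0) {a b : ℕ}
    (hab : a ≤ b) (hb : b ≤ m) :
    HasSignedWalk A (b - a) (v a) (v b)
      (∏ k ∈ Finset.Ico a b, Real.sign (A (v (k + 1)) (v k))) := by
  refine ⟨fun k => v (a + k), rfl, ?_, fun k hk => hv (a + k) (by omega), ?_⟩
  · simp only [Nat.add_sub_cancel' hab]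
  · rw [Finset.prod_Ico_eq_prod_range]
    rfl

theorem sign_eq (h : HasSignedWalk A m i j s) : s = 1 ∨ s = -1 := by
  obtain ⟨v, -, -, hv, rfl⟩ := h
  refine Finset.prod_induction _ (fun x : ℝ => x = 1 ∨ x = -1) ?_ (Or.inl rfl) fun k hk =>
    (Real.sign_apply_eq_of_ne_zero _ (hv k (Finset.mem_range.1 hk))).symm
  rintro a b (rfl | rfl) (rfl | rfl) <;> norm_num

theorem exists_of_reflTransGen (h : Relation.ReflTransGen (arcOf A) i j) :
    ∃ m s, HasSignedWalk A m i j s := by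
  induction h with
  | refl => exact ⟨0, 1, refl i⟩
  | tail _ hjl ih =>
    obtain ⟨m, s, h⟩ := ih
    exact ⟨_, _, h.trans (of_arc hjl)⟩

end HasSignedWalk

/-- If no closed walk of `Γ(A)` is negative, then `Γ(A)` is structurally balanced. -/
theorem exists_balanced_of_no_negative_closed_walk {n : ℕ} {A : Matrix (Fin n) (Fin n) ℝ}
    (hsc : ∀ i j : Fin n, Relation.ReflTransGen (arcOf A) i j)
    (hneg : ∀ m i, ¬ HasSignedWalk A m i i (-1)) :
    ∃ b : Fin n → ℝ, (∀ i, b i = 1 ∨ b i = -1) ∧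
      ∀ i j : Fin n, A j i ≠ 0 → Real.sign (A j i) = b i * b j := by
  rcases isEmpty_or_nonempty (Fin n) with _ | ⟨⟨r⟩⟩
  · exact ⟨fun _ => 1, isEmptyElim, isEmptyElim⟩
  choose len b hb using fun i => HasSignedWalk.exists_of_reflTransGen (hsc r i)
  refine ⟨b, fun i => (hb i).sign_eq, fun i j hij => ?_⟩
  obtain ⟨q, u, hu⟩ := HasSignedWalk.exists_of_reflTransGen (hsc j r)
  have closed_sign {m : ℕ} {s : ℝ} (h : HasSignedWalk A m r r s) : s = 1 :=
    h.sign_eq.resolve_right fun hs => hneg m r (hs ▸ h)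
  have h₁ := closed_sign ((hb j).trans hu)
  have h₂ := closed_sign (((hb i).trans (.of_arc hij)).trans hu)
  rcases (hb i).sign_eq with hi | hi <;> rcases hu.sign_eq with rfl | rfl <;>
    rw [hi] at h₂ ⊢ <;> linarith

/-- A shortest negative closed walk has no repeated vertex. -/
theorem HasSignedWalk.ne_of_minimal {n m : ℕ} {A : Matrix (Fin n) (Fin n) ℝ}
    {v : ℕ → Fin n} (hclosed : v 0 = v m) (hv : ∀ k < m, A (v (k + 1)) (v k) ≠ 0)
    (hsign : ∏ k ∈ Finset.range m, Real.sign (A (v (k + 1)) (v k)) = -1)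
    (hmin : ∀ p < m, ∀ i, ¬ HasSignedWalk A p i i (-1)) {k l : ℕ} (hkl : k < l) (hl : l < m) :
    v k ≠ v l := by
  intro heq
  have inner := segment hv hkl.le hl.le
  have left := segment hv k.zero_le (hkl.trans hl).le
  have right := segment hv hl.le le_rfl
  rw [← heq, ← hclosed] at right
  rw [← heq] at inner
  rw [Finset.range_eq_Ico, ← Finset.prod_Ico_consecutive _ k.zero_le (hkl.trans hl).le,
    ← Finset.prod_Ico_consecutive _ hkl.le hl.le] at hsign
  rcases inner.sign_eq with h | h
  · rw [h, one_mul] at hsign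
    have outer := left.trans right
    rw [hsign] at outer
    exact hmin _ (by omega) _ outer
  · rw [h] at inner
    exact hmin _ (by omega) _ inner

/-- Corollary 1: if the signed digraph `Γ(A)` is strongly connected and structurally
unbalanced, then there exists a negative directed cycle in `Γ(A)`: a sequence of vertices
`v 0, v 1, …, v m` with `v 0 = v m`, with `v 0, …, v (m-1)` pairwise distinct, each
consecutive pair an arc, and the product of the signs of the traversed arcs equal to `-1`. -/
theorem exists_negative_cycle {n : ℕ}
    (A : Matrix (Fin n) (Fin n) ℝ)
    (hsc : ∀ i j : Fin n, Relation.ReflTransGen (arcOf A) i j)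
    (hunbal : ¬ ∃ b : Fin n → ℝ, (∀ i, b i = 1 ∨ b i = -1) ∧
      ∀ i j : Fin n, A j i ≠ 0 → Real.sign (A j i) = b i * b j) :
    ∃ m : ℕ, 0 < m ∧ ∃ v : ℕ → Fin n, v 0 = v m ∧
      (∀ k l, k < m → l < m → v k = v l → k = l) ∧
      (∀ k, k < m → A (v (k + 1)) (v k) ≠ 0) ∧
      (∏ k ∈ Finset.range m, Real.sign (A (v (k + 1)) (v k))) = -1 := by
  classical
  have hex : ∃ m i, HasSignedWalk A m i i (-1) := by
    by_contra! hneg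
    exact hunbal (exists_balanced_of_no_negative_closed_walk hsc hneg)
  obtain ⟨i, v, hv0, hvm, hv, hsign⟩ := Nat.find_spec hex
  have hclosed := hv0.trans hvm.symm
  have hmin : ∀ p < Nat.find hex, ∀ i, ¬ HasSignedWalk A p i i (-1) :=
    fun p hp i h => Nat.find_min hex hp ⟨i, h⟩
  refine ⟨Nat.find hex, Nat.pos_of_ne_zero fun h => ?_, v, hclosed, fun k l hk hl hkl => ?_,
    hv, hsign⟩
  · rw [h, Finset.prod_range_zero] at hsign
    norm_num at hsign
  · by_contra hne
    rcases lt_or_gt_of_ne hne with hlt | hlt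
    · exact HasSignedWalk.ne_of_minimal hclosed hv hsign hmin hlt hl hkl
    · exact HasSignedWalk.ne_of_minimal hclosed hv hsign hmin hlt hk hkl.symm
end

section
/- (Corollary 2) Let A(p), A(p+1), …, A(q) (q ≥ p) be real n×n matrices. Suppose the union of their signed digraphs is strongly connected and the sequence is jointly structurally balanced with respect to a clustering b : Fin n → ℝ (b i ∈ {1, −1} for all i). Then the union of the digraphs Γ(Ā(p)), …, Γ(Ā(q)) of the expanded matrices consists of two disjoint strongly connected components of the same size n: letting V₁ = {inl i : b i = 1} ∪ {inr j : b j = −1} and V₂ = {inl i : b i = −1} ∪ {inr j : b j = 1}, there is no arc of the union between V₁ and V₂ in either direction, and the subgraphs induced on V₁ and on V₂ are each strongly connected. -/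
/-- Arc relation of the union of the signed digraphs `Γ(A p), …, Γ(A q)`:
an arc from `i` to `j` whenever `A t j i ≠ 0` for some `t ∈ {p, …, q}`. -/
def unionArc {n : ℕ} (A : ℕ → Matrix (Fin n) (Fin n) ℝ) (p q : ℕ) (i j : Fin n) : Prop :=
  ∃ t : ℕ, p ≤ t ∧ t ≤ q ∧ A t j i ≠ 0

/-- Arc relation of the union of the expanded digraphs `Γ(Ā p), …, Γ(Ā q)`:
an arc from `u` to `v` whenever `Ā(t) v u ≠ 0` for some `t ∈ {p, …, q}`. -/
def unionBarArc {n : ℕ} (A : ℕ → Matrix (Fin n) (Fin n) ℝ) (p q : ℕ)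
    (u v : Fin n ⊕ Fin n) : Prop :=
  ∃ t : ℕ, p ≤ t ∧ t ≤ q ∧ expand (A t) v u ≠ 0

/-- The value of the clustering `b` on the doubled vertex set: `b i` on `inl i`, `-b i` on `inr i`. -/
def doubledCluster {n : ℕ} (b : Fin n → ℝ) : Fin n ⊕ Fin n → ℝ :=
  Sum.elim b fun j => -b j

open Classical in
/-- The copy of the vertex `i` at which the doubled clustering takes the value `ε`. -/
noncomputable def clusterLift {n : ℕ} (b : Fin n → ℝ) (ε : ℝ) (i : Fin n) : Fin n ⊕ Fin n :=
  if b i = ε then Sum.inl i else Sum.inr i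

theorem clusterLift_injective {n : ℕ} (b : Fin n → ℝ) (ε : ℝ) :
    Function.Injective (clusterLift b ε) := by
  intro i j h
  unfold clusterLift at h
  split_ifs at h <;> simpa using h

theorem doubledCluster_clusterLift {n : ℕ} {b : Fin n → ℝ} (hb : ∀ i, b i = 1 ∨ b i = -1)
    {ε : ℝ} (hε : ε = 1 ∨ ε = -1) (i : Fin n) : doubledCluster b (clusterLift b ε i) = ε := by
  unfold clusterLift doubledCluster
  split_ifs with h
  · exact h
  · rcases hb i with hi | hi <;> rcases hε with rfl | rfl <;> simp_all

theorem range_clusterLift {n : ℕ} {b : Fin n → ℝ} (hb : ∀ i, b i = 1 ∨ b i = -1)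
    {ε : ℝ} (hε : ε = 1 ∨ ε = -1) :
    Set.range (clusterLift b ε) = {u | doubledCluster b u = ε} := by
  ext u
  constructor
  · rintro ⟨i, rfl⟩
    exact doubledCluster_clusterLift hb hε i
  · rintro rfl
    cases u with
    | inl i => exact ⟨i, by simp [clusterLift, doubledCluster]⟩
    | inr i =>
      refine ⟨i, if_neg fun h => ?_⟩
      rcases hb i with hi | hi <;> norm_num [doubledCluster, hi] at h

theorem ncard_doubledCluster_eq {n : ℕ} {b : Fin n → ℝ} (hb : ∀ i, b i = 1 ∨ b i = -1)
    {ε : ℝ} (hε : ε = 1 ∨ ε = -1) : {u | doubledCluster b u = ε}.ncard = n := by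
  rw [← range_clusterLift hb hε, Set.ncard_range_of_injective (clusterLift_injective b ε),
    Nat.card_fin]

/-- Under joint structural balance, arcs of the expanded union preserve the doubled clustering. -/
theorem unionBarArc.doubledCluster_eq {n : ℕ} {A : ℕ → Matrix (Fin n) (Fin n) ℝ} {p q : ℕ}
    {b : Fin n → ℝ}
    (hbal : ∀ t : ℕ, p ≤ t → t ≤ q → ∀ i j : Fin n,
      (0 < A t j i → b i = b j) ∧ (A t j i < 0 → b i = -b j))
    {u v : Fin n ⊕ Fin n} (h : unionBarArc A p q u v) :
    doubledCluster b u = doubledCluster b v := by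
  obtain ⟨t, hp, hq, h⟩ := h
  rcases u with i | i <;> rcases v with j | j <;>
    have := hbal t hp hq i j <;>
    simp only [expand, Matrix.of_apply, ne_eq, max_eq_right_iff, not_le, Left.neg_nonpos_iff] at h <;>
    simp [doubledCluster, this.1, this.2, h]

/-- An arc of the union lifts to an arc between the copies of its ends with a given value of the
doubled clustering. -/
theorem unionArc.unionBarArc_clusterLift {n : ℕ} {A : ℕ → Matrix (Fin n) (Fin n) ℝ} {p q : ℕ}
    {b : Fin n → ℝ} (hb : ∀ i, b i = 1 ∨ b i = -1)
    (hbal : ∀ t : ℕ, p ≤ t → t ≤ q → ∀ i j : Fin n,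
      (0 < A t j i → b i = b j) ∧ (A t j i < 0 → b i = -b j))
    {ε : ℝ} (hε : ε = 1 ∨ ε = -1) {i j : Fin n} (h : unionArc A p q i j) :
    unionBarArc A p q (clusterLift b ε i) (clusterLift b ε j) := by
  obtain ⟨t, hp, hq, h⟩ := h
  refine ⟨t, hp, hq, ?_⟩
  rcases lt_or_gt_of_ne h with h | h
  · have hij := (hbal t hp hq i j).2 h
    rcases hb j with hj | hj <;> rcases hε with rfl | rfl <;>
      norm_num [clusterLift, expand, hij, hj, h]
  · have hij := (hbal t hp hq i j).1 h
    rcases hb j with hj | hj <;> rcases hε with rfl | rfl <;>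
      norm_num [clusterLift, expand, hij, hj, h]

/-- Each level set of the doubled clustering induces a strongly connected subgraph. -/
theorem reflTransGen_unionBarArc_of_doubledCluster_eq {n : ℕ}
    {A : ℕ → Matrix (Fin n) (Fin n) ℝ} {p q : ℕ}
    (hsc : ∀ i j : Fin n, Relation.ReflTransGen (unionArc A p q) i j)
    {b : Fin n → ℝ} (hb : ∀ i, b i = 1 ∨ b i = -1)
    (hbal : ∀ t : ℕ, p ≤ t → t ≤ q → ∀ i j : Fin n,
      (0 < A t j i → b i = b j) ∧ (A t j i < 0 → b i = -b j))
    {ε : ℝ} (hε : ε = 1 ∨ ε = -1) :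
    ∀ u ∈ {u | doubledCluster b u = ε}, ∀ v ∈ {u | doubledCluster b u = ε},
      Relation.ReflTransGen (fun a c => a ∈ {u | doubledCluster b u = ε} ∧
        c ∈ {u | doubledCluster b u = ε} ∧ unionBarArc A p q a c) u v := by
  simp only [← range_clusterLift hb hε]
  rintro _ ⟨i, rfl⟩ _ ⟨j, rfl⟩
  exact (hsc i j).lift (clusterLift b ε) fun k l hkl =>
    ⟨⟨k, rfl⟩, ⟨l, rfl⟩, hkl.unionBarArc_clusterLift hb hbal hε⟩

/-- Corollary 2: if the union of the signed digraphs of `A p, …, A q` is strongly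
connected and the sequence is jointly structurally balanced with respect to the
clustering `b`, then the union of the expanded digraphs consists of two disjoint
strongly connected components of the same size `n`, namely
`V₁ = {inl i : b i = 1} ∪ {inr j : b j = -1}` and `V₂ = {inl i : b i = -1} ∪ {inr j : b j = 1}`,
with no arc between them in either direction and the induced subgraph on each
strongly connected. -/
theorem union_expanded_graph_of_jointly_balanced_two_components {n : ℕ}
    (A : ℕ → Matrix (Fin n) (Fin n) ℝ) (p q : ℕ) (hpq : p ≤ q)
    (hsc : ∀ i j : Fin n, Relation.ReflTransGen (unionArc A p q) i j)
    (b : Fin n → ℝ) (hb : ∀ i, b i = 1 ∨ b i = -1)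
    (hbal : ∀ t : ℕ, p ≤ t → t ≤ q → ∀ i j : Fin n,
      (0 < A t j i → b i = b j) ∧ (A t j i < 0 → b i = -b j)) :
    ∀ V₁ V₂ : Set (Fin n ⊕ Fin n),
      V₁ = {u | Sum.elim (fun i => b i = 1) (fun j => b j = -1) u} →
      V₂ = {u | Sum.elim (fun i => b i = -1) (fun j => b j = 1) u} →
      Disjoint V₁ V₂ ∧ V₁.ncard = n ∧ V₂.ncard = n ∧
      (∀ u ∈ V₁, ∀ v ∈ V₂, ¬ unionBarArc A p q u v ∧ ¬ unionBarArc A p q v u) ∧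
      (∀ u ∈ V₁, ∀ v ∈ V₁,
        Relation.ReflTransGen (fun a c => a ∈ V₁ ∧ c ∈ V₁ ∧ unionBarArc A p q a c) u v) ∧
      (∀ u ∈ V₂, ∀ v ∈ V₂,
        Relation.ReflTransGen (fun a c => a ∈ V₂ ∧ c ∈ V₂ ∧ unionBarArc A p q a c) u v) := by
  rintro V₁ V₂ hV₁ hV₂
  replace hV₁ : V₁ = {u | doubledCluster b u = 1} := by
    rw [hV₁]
    ext (i | i) <;> simp [doubledCluster, neg_eq_iff_eq_neg]
  replace hV₂ : V₂ = {u | doubledCluster b u = -1} := by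
    rw [hV₂]
    ext (i | i) <;> simp [doubledCluster]
  subst hV₁ hV₂
  have hne {u v : Fin n ⊕ Fin n} (hu : doubledCluster b u = 1) (hv : doubledCluster b v = -1) :
      doubledCluster b u ≠ doubledCluster b v := by
    rw [hu, hv]
    norm_num
  refine ⟨Set.disjoint_left.2 fun u hu hv => hne hu hv rfl,
    ncard_doubledCluster_eq hb (.inl rfl), ncard_doubledCluster_eq hb (.inr rfl),
    fun u hu v hv => ⟨fun h => hne hu hv (h.doubledCluster_eq hbal),
      fun h => hne hu hv (h.doubledCluster_eq hbal).symm⟩,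
    reflTransGen_unionBarArc_of_doubledCluster_eq hsc hb hbal (.inl rfl),
    reflTransGen_unionBarArc_of_doubledCluster_eq hsc hb hbal (.inr rfl)⟩
end

section
/- (Lemma 2) Let A : Matrix (Fin n) (Fin n) ℝ and let i, j ∈ Fin n. If the signed digraph Γ(A) has a directed path from i to j whose sign (the product of the signs of its arcs) is positive, then the digraph Γ(Ā) of the expanded matrix has a directed path from inl i to inl j. If Γ(A) has a directed path from i to j whose sign is negative, then Γ(Ā) has a directed path from inl i to inr j. In particular, whenever Γ(A) has a directed path from i to j, Γ(Ā) has a directed path from inl i to inl j or from inl i to inr j. -/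
theorem barArc_inl_inl_of_pos {n : ℕ} {A : Matrix (Fin n) (Fin n) ℝ} {i j : Fin n}
    (h : 0 < A j i) : barArc A (Sum.inl i) (Sum.inl j) := by
  simpa [barArc, expand] using h

theorem barArc_inr_inr_of_pos {n : ℕ} {A : Matrix (Fin n) (Fin n) ℝ} {i j : Fin n}
    (h : 0 < A j i) : barArc A (Sum.inr i) (Sum.inr j) := by
  simpa [barArc, expand] using h

theorem barArc_inl_inr_of_neg {n : ℕ} {A : Matrix (Fin n) (Fin n) ℝ} {i j : Fin n}
    (h : A j i < 0) : barArc A (Sum.inl i) (Sum.inr j) := by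
  simpa [barArc, expand] using h

theorem barArc_inr_inl_of_neg {n : ℕ} {A : Matrix (Fin n) (Fin n) ℝ} {i j : Fin n}
    (h : A j i < 0) : barArc A (Sum.inr i) (Sum.inl j) := by
  simpa [barArc, expand] using h

/-- A signed walk lifts to a walk starting at `inl (v 0)` whose final copy records its sign. -/
theorem reflTransGen_barArc_of_walk {n : ℕ} (A : Matrix (Fin n) (Fin n) ℝ) (v : ℕ → Fin n)
    (m : ℕ) (harc : ∀ k, k < m → A (v (k + 1)) (v k) ≠ 0) :
    ((∏ k ∈ Finset.range m, Real.sign (A (v (k + 1)) (v k))) = 1 ∧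
        Relation.ReflTransGen (barArc A) (Sum.inl (v 0)) (Sum.inl (v m))) ∨
    ((∏ k ∈ Finset.range m, Real.sign (A (v (k + 1)) (v k))) = -1 ∧
        Relation.ReflTransGen (barArc A) (Sum.inl (v 0)) (Sum.inr (v m))) := by
  induction m with
  | zero => exact Or.inl ⟨by simp, .refl⟩
  | succ m ih =>
    rw [Finset.prod_range_succ]
    rcases ih fun k hk => harc k (hk.trans m.lt_succ_self) with ⟨hs, hp⟩ | ⟨hs, hp⟩ <;>
      rcases (harc m m.lt_succ_self).lt_or_gt with h | h
    · exact Or.inr ⟨by simp [hs, Real.sign_of_neg h], hp.tail (barArc_inl_inr_of_neg h)⟩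
    · exact Or.inl ⟨by simp [hs, Real.sign_of_pos h], hp.tail (barArc_inl_inl_of_pos h)⟩
    · exact Or.inl ⟨by simp [hs, Real.sign_of_neg h], hp.tail (barArc_inr_inl_of_neg h)⟩
    · exact Or.inr ⟨by simp [hs, Real.sign_of_pos h], hp.tail (barArc_inr_inr_of_pos h)⟩

/-- Lemma 2: if `Γ(A)` has a directed path from `i` to `j` with positive sign then
`Γ(Ā)` has a directed path from `inl i` to `inl j`; if the sign is negative then `Γ(Ā)`
has a directed path from `inl i` to `inr j`; in particular whenever `Γ(A)` has a directed
path from `i` to `j`, `Γ(Ā)` has a directed path from `inl i` to `inl j` or to `inr j`. -/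
theorem expanded_path_of_signed_path {n : ℕ}
    (A : Matrix (Fin n) (Fin n) ℝ) (i j : Fin n)
    (m : ℕ) (v : ℕ → Fin n) (hv0 : v 0 = i) (hvm : v m = j)
    (hdistinct : ∀ k l, k ≤ m → l ≤ m → v k = v l → k = l)
    (harc : ∀ k, k < m → A (v (k + 1)) (v k) ≠ 0) :
    ((∏ k ∈ Finset.range m, Real.sign (A (v (k + 1)) (v k))) = 1 →
        Relation.ReflTransGen (barArc A) (Sum.inl i) (Sum.inl j)) ∧
    ((∏ k ∈ Finset.range m, Real.sign (A (v (k + 1)) (v k))) = -1 →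
        Relation.ReflTransGen (barArc A) (Sum.inl i) (Sum.inr j)) ∧
    (Relation.ReflTransGen (barArc A) (Sum.inl i) (Sum.inl j) ∨
        Relation.ReflTransGen (barArc A) (Sum.inl i) (Sum.inr j)) := by
  subst hv0 hvm
  rcases reflTransGen_barArc_of_walk A v m harc with ⟨hs, hp⟩ | ⟨hs, hp⟩
  · exact ⟨fun _ => hp, fun h => by norm_num [hs] at h, Or.inl hp⟩
  · exact ⟨fun h => by norm_num [hs] at h, fun _ => hp, Or.inr hp⟩
end

section
/- (Lemma 3) Let A : Matrix (Fin n) (Fin n) ℝ and let i, j ∈ Fin n, and consider the digraph Γ(Ā) of the expanded matrix Ā. Then: Γ(Ā) has a directed path from inl i to inl j if and only if it has a directed path from inr i to inr j; and Γ(Ā) has a directed path from inl i to inr j if and only if it has a directed path from inr i to inl j. -/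
/-- Exchanging the two copies of `Fin n` leaves the expanded matrix unchanged. -/
theorem expand_swap {n : ℕ} (A : Matrix (Fin n) (Fin n) ℝ) (u v : Fin n ⊕ Fin n) :
    expand A u.swap v.swap = expand A u v := by
  cases u <;> cases v <;> rfl

/-- Exchanging the two copies of `Fin n` preserves directed paths in `Γ(Ā)`. -/
theorem reflTransGen_barArc_swap {n : ℕ} (A : Matrix (Fin n) (Fin n) ℝ)
    {u v : Fin n ⊕ Fin n} (h : Relation.ReflTransGen (barArc A) u v) :
    Relation.ReflTransGen (barArc A) u.swap v.swap :=
  h.lift Sum.swap fun a b hab => (expand_swap A b a).trans_ne hab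

/-- Lemma 3: `Γ(Ā)` has a directed path from `inl i` to `inl j` iff it has one from
`inr i` to `inr j`, and it has a directed path from `inl i` to `inr j` iff it has one
from `inr i` to `inl j`. -/
theorem expanded_path_symmetry {n : ℕ}
    (A : Matrix (Fin n) (Fin n) ℝ) (i j : Fin n) :
    (Relation.ReflTransGen (barArc A) (Sum.inl i) (Sum.inl j) ↔
      Relation.ReflTransGen (barArc A) (Sum.inr i) (Sum.inr j)) ∧
    (Relation.ReflTransGen (barArc A) (Sum.inl i) (Sum.inr j) ↔
      Relation.ReflTransGen (barArc A) (Sum.inr i) (Sum.inl j)) := by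
  exact ⟨⟨reflTransGen_barArc_swap A, reflTransGen_barArc_swap A⟩,
    ⟨reflTransGen_barArc_swap A, reflTransGen_barArc_swap A⟩⟩
end
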